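/- arXiv:math/0208141 — 12 statements merged into one kernel-verified Lean document; each statement's English description precedes it below -/
import Mathlib

section
/- Let 𝒰 be a uniform cover of U_∞ such that diam(U) < 1 for every U ∈ 𝒰. Then there exists a point x ∈ U_∞ such that the set {U ∈ 𝒰 : x ∈ U} is infinite. -/
open BoundedContinuousFunction

/-- The unit cube of `ℓ∞(ℕ)`: bounded functions `ℕ → ℝ` with all values in `[0,1]`,
with the supremum metric (inherited from `ℕ →ᵇ ℝ`). -/
def Uinf : Set (ℕ →ᵇ ℝ) := {x | ∀ i, x i ∈ Set.Icc (0 : ℝ) 1}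

/-- A family of subsets of a metric space is a uniform cover if it covers the space
and has a positive Lebesgue number. -/
def IsUniformCover {X : Type*} [PseudoMetricSpace X] (𝒰 : Set (Set X)) : Prop :=
  ⋃₀ 𝒰 = Set.univ ∧ ∃ ε > (0 : ℝ), ∀ S : Set X, Metric.diam S < ε → ∃ U ∈ 𝒰, S ⊆ U

namespace InfinitaryLebesgue

/-! ### An ideal of sets of functions `ℕ → ℕ` -/

/-- The list of the first `n` values of `h`. -/
def initSeg (h : ℕ → ℕ) (n : ℕ) : List ℕ := (List.range n).map h

lemma length_initSeg (h : ℕ → ℕ) (n : ℕ) : (initSeg h n).length = n := by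
  simp [initSeg]

lemma take_initSeg (h : ℕ → ℕ) {n i : ℕ} (hn : n ≤ i) :
    (initSeg h i).take n = initSeg h n := by
  simp [initSeg, ← List.map_take, List.take_range, Nat.min_eq_left hn]

/-- A set of functions is null if some strategy `φ`, which reads initial segments, exceeds every
member of the set infinitely often. -/
def Null (X : Set (ℕ → ℕ)) : Prop :=
  ∃ φ : List ℕ → ℕ, ∀ h ∈ X, ∀ n, ∃ i ≥ n, h i < φ (initSeg h i)

/-- A set of functions is positive at the stem `σ` if it has members that extend `σ` and
dominate any prescribed function beyond `σ`. -/
def PositiveAt (σ : List ℕ) (T : Set (ℕ → ℕ)) : Prop :=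
  ∀ g : ℕ → ℕ, ∃ h ∈ T, initSeg h σ.length = σ ∧ ∀ i ≥ σ.length, g i ≤ h i

lemma Null.mono {X Y : Set (ℕ → ℕ)} (hY : Null Y) (hXY : X ⊆ Y) : Null X := by
  obtain ⟨φ, hφ⟩ := hY
  exact ⟨φ, fun h hh => hφ h (hXY hh)⟩

lemma null_iUnion_nat {X : ℕ → Set (ℕ → ℕ)} (hX : ∀ m, Null (X m)) : Null (⋃ m, X m) := by
  choose φ hφ using hX
  refine ⟨fun s => ∑ m ∈ Finset.range (s.length + 1), φ m s, fun h hh n => ?_⟩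
  obtain ⟨m, hm⟩ := Set.mem_iUnion.1 hh
  obtain ⟨i, hi, hlt⟩ := hφ m h hm (max n m)
  refine ⟨i, (le_max_left _ _).trans hi, hlt.trans_le ?_⟩
  refine Finset.single_le_sum (f := fun m => φ m (initSeg h i)) (fun _ _ => Nat.zero_le _) ?_
  rw [length_initSeg, Finset.mem_range]
  have := (le_max_right n m).trans hi
  omega

lemma null_iUnion {ι : Type*} [Countable ι] [Nonempty ι] {X : ι → Set (ℕ → ℕ)}
    (hX : ∀ i, Null (X i)) : Null (⋃ i, X i) := by
  obtain ⟨e, he⟩ := exists_surjective_nat ι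
  rw [← he.iUnion_comp]
  exact null_iUnion_nat fun m => hX (e m)

/-- Values of the function that follows the strategy `φ` exactly, as a list. -/
def followList (φ : List ℕ → ℕ) : ℕ → List ℕ
  | 0 => []
  | n + 1 => followList φ n ++ [φ (followList φ n)]

lemma not_null_univ : ¬ Null Set.univ := by
  rintro ⟨φ, hφ⟩
  have key : ∀ n, initSeg (fun i => φ (followList φ i)) n = followList φ n := by
    intro n
    induction n with
    | zero => rfl
    | succ n ih =>
      rw [followList, initSeg, List.range_succ, List.map_append, ← initSeg, ih]
      rfl
  obtain ⟨i, -, hi⟩ := hφ (fun i => φ (followList φ i)) trivial 0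
  rw [key] at hi
  exact lt_irrefl _ hi

lemma exists_positiveAt_of_not_null {T : Set (ℕ → ℕ)} (hT : ¬ Null T) :
    ∃ σ, PositiveAt σ T := by
  by_contra! hcon
  simp only [PositiveAt, not_forall, not_exists, not_and] at hcon
  choose g hg using hcon
  refine hT ⟨fun s => ∑ n ∈ Finset.range (s.length + 1), g (s.take n) s.length,
    fun h hh n => ?_⟩
  obtain ⟨i, hi, hlt⟩ := hg (initSeg h n) h hh (by rw [length_initSeg])
  rw [length_initSeg] at hi
  refine ⟨i, hi, (not_le.1 hlt).trans_le ?_⟩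
  simp only [length_initSeg]
  calc g (initSeg h n) i = g ((initSeg h i).take n) i := by rw [take_initSeg h hi]
    _ ≤ _ := Finset.single_le_sum (f := fun n => g ((initSeg h i).take n) i)
        (fun _ _ => Nat.zero_le _) (Finset.mem_range.2 (by omega))

/-! ### Counting functions of tuples -/

/-- The number of functions in `p` whose value at `c` is at most `t`. -/
def cnt (p : List (ℕ → ℕ)) (c t : ℕ) : ℕ := p.countP fun h => h c ≤ t

lemma cnt_cons (h : ℕ → ℕ) (p : List (ℕ → ℕ)) (c t : ℕ) :
    cnt (h :: p) c t = cnt p c t + if h c ≤ t then 1 else 0 := by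
  simp [cnt, List.countP_cons]

/-- `Along Q stems p`: the tuple `p` can be prolonged, by positively many functions at each of the
given stems, to tuples with property `Q`. -/
def Along (Q : List (ℕ → ℕ) → Prop) : List (List ℕ) → List (ℕ → ℕ) → Prop
  | [], p => Q p
  | σ :: stems, p => PositiveAt σ {h | Along Q stems (h :: p)}

/-- The counting functions of the tuples `P i` differ pairwise by at most one, and agree above some
function. -/
def Interlaced {ι : Type*} (P : ι → List (ℕ → ℕ)) : Prop :=
  ∃ G : ℕ → ℕ, ∀ i j c t, cnt (P i) c t ≤ cnt (P j) c t + 1 ∧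
    (G c ≤ t → cnt (P i) c t = cnt (P j) c t)

lemma Interlaced.cons {ι : Type*} [Fintype ι] {P : ι → List (ℕ → ℕ)} {G : ℕ → ℕ}
    (hG : ∀ i j c t, cnt (P i) c t ≤ cnt (P j) c t + 1 ∧
      (G c ≤ t → cnt (P i) c t = cnt (P j) c t))
    {h : ι → ℕ → ℕ} (hh : ∀ c, (∀ i j, h i c = h j c) ∨ ∀ i, G c ≤ h i c) :
    Interlaced fun i => h i :: P i := by
  refine ⟨fun c => G c + ∑ i, h i c, fun i j c t => ?_⟩
  have hle : ∀ i, h i c ≤ ∑ i, h i c := fun i =>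
    Finset.single_le_sum (f := fun i => h i c) (fun _ _ => Nat.zero_le _) (Finset.mem_univ i)
  have h1 := hG i j c t
  have hi := hle i
  have hj := hle j
  simp only [cnt_cons]
  rcases hh c with hc | hc
  · have := hc i j
    grind
  · have := hc i
    have := hc j
    grind

/-- Finitely many interlaced tuples can be prolonged along the same stems, each to a tuple with its
own property, so that they remain interlaced. -/
lemma exists_interlaced {ι : Type*} [Fintype ι] {Q : ι → List (ℕ → ℕ) → Prop}
    (stems : List (List ℕ)) (P : ι → List (ℕ → ℕ)) (hP : ∀ i, Along (Q i) stems (P i))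
    (hI : Interlaced P) : ∃ P' : ι → List (ℕ → ℕ), (∀ i, Q i (P' i)) ∧ Interlaced P' := by
  induction stems generalizing P with
  | nil => exact ⟨P, hP, hI⟩
  | cons σ stems ih =>
    obtain ⟨G, hG⟩ := hI
    choose h hmem hσ hdom using fun i => hP i G
    refine ih (fun i => h i :: P i) hmem (Interlaced.cons hG fun c => ?_)
    rcases lt_or_ge c σ.length with hc | hc
    · left
      intro i j
      have hij := congrArg (fun l => l[c]?) ((hσ i).trans (hσ j).symm)
      simpa [initSeg, hc] using hij
    · exact Or.inr fun i => hdom i c hc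

lemma exists_along_dominating {Q : List (ℕ → ℕ) → Prop} (g : ℕ → ℕ) (stems : List (List ℕ))
    (p : List (ℕ → ℕ)) (hp : Along Q stems p) :
    ∃ q : List (ℕ → ℕ), Q (q ++ p) ∧ q.length = stems.length ∧
      ∀ h ∈ q, ∀ c ≥ (stems.map List.length).sum, g c ≤ h c := by
  induction stems generalizing p with
  | nil => exact ⟨[], hp, rfl, by simp⟩
  | cons σ stems ih =>
    obtain ⟨h, hmem, -, hdom⟩ := hp g
    obtain ⟨q, hQ, hlen, hq⟩ := ih (h :: p) hmem
    refine ⟨q ++ [h], by simpa using hQ, by simp [hlen], fun h' hh' c hc => ?_⟩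
    simp only [List.map_cons, List.sum_cons] at hc
    rcases List.mem_append.1 hh' with h1 | h1
    · exact hq h' h1 c (by omega)
    · rw [List.mem_singleton.1 h1]
      exact hdom c (by omega)

/-- Two tuples along the same stems whose counting functions are as far apart as possible
at some place. -/
lemma exists_separated {Q : List (ℕ → ℕ) → Prop} {stems : List (List ℕ)}
    (hQ : Along Q stems []) :
    ∃ p q c t, Q p ∧ Q q ∧ cnt p c t = stems.length ∧ cnt q c t = 0 := by
  obtain ⟨p, hp, hlen, -⟩ := exists_along_dominating 0 stems [] hQ
  set c := (stems.map List.length).sum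
  set t := (p.map fun h => h c).sum
  obtain ⟨q, hq, -, hdom⟩ := exists_along_dominating (fun _ => t + 1) stems [] hQ
  rw [List.append_nil] at hp hq
  refine ⟨p, q, c, t, hp, hq, ?_, ?_⟩
  · rw [← hlen, cnt, List.countP_eq_length]
    intro h hh
    simpa using List.single_le_sum (by simp) _ (List.mem_map_of_mem (f := fun h => h c) hh)
  · rw [cnt, List.countP_eq_zero]
    intro h hh
    have := hdom h hh c le_rfl
    simp only [decide_eq_true_eq]
    omega

/-- If interlaced families of tuples of order at most `N` have at most `N` colours, then every tuple
can be prolonged positively often with a constant colour. -/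
lemma exists_along_const {α : Type*} (col : List (ℕ → ℕ) → α) (ord : List (ℕ → ℕ) → ℕ)
    (H : ∀ (N : ℕ) (P : Fin (N + 1) → List (ℕ → ℕ)), Interlaced P → (∀ i, ord (P i) ≤ N) →
      ¬ Function.Injective fun i => col (P i))
    (m : ℕ) (p : List (ℕ → ℕ)) :
    ∃ N u stems, stems.length = m ∧ Along (fun q => col q = u ∧ ord q ≤ N) stems p := by
  induction m generalizing p with
  | zero => exact ⟨ord p, col p, [], rfl, rfl, le_rfl⟩
  | succ m ih =>
    choose N u stems hlen halong using fun h => ih (h :: p)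
    obtain ⟨⟨M, l⟩, hS⟩ : ∃ a : ℕ × List (List ℕ), ¬ Null {h | (N h, stems h) = a} := by
      by_contra! hcon
      refine not_null_univ ((null_iUnion hcon).mono fun h _ => ?_)
      exact Set.mem_iUnion.2 ⟨_, rfl⟩
    set S := {h | (N h, stems h) = (M, l)}
    have hSalong : ∀ h ∈ S, Along (fun q => col q = u h ∧ ord q ≤ M) l (h :: p) ∧
        l.length = m := by
      intro h hh
      obtain ⟨h1, h2⟩ := Prod.mk.inj hh
      rw [← h1, ← h2]
      exact ⟨halong h, hlen h⟩
    have hSne : S.Nonempty := by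
      rw [Set.nonempty_iff_ne_empty]
      intro he
      exact hS (he ▸ ⟨fun _ => 0, by simp⟩)
    by_cases hcase : ∃ v, ¬ Null {h | Along (fun q => col q = v ∧ ord q ≤ M) l (h :: p)}
    · obtain ⟨v, hv⟩ := hcase
      obtain ⟨σ, hσ⟩ := exists_positiveAt_of_not_null hv
      obtain ⟨h, hh⟩ := hSne
      exact ⟨M, v, σ :: l, by simp [(hSalong h hh).2], hσ⟩
    · push Not at hcase
      exfalso
      have hinf : (u '' S).Infinite := by
        intro hfin
        have := hfin.countable.to_subtype
        have : Nonempty (u '' S) := (hSne.image u).to_subtype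
        refine hS ((null_iUnion fun v : u '' S => hcase v).mono fun h hh => ?_)
        exact Set.mem_iUnion.2 ⟨⟨u h, Set.mem_image_of_mem u hh⟩, (hSalong h hh).1⟩
      let e := hinf.natEmbedding
      choose h hhS hhu using fun i : Fin (M + 1) => (e i).2
      obtain ⟨P, hP, hPI⟩ := exists_interlaced
        (Q := fun i q => col q = u (h i) ∧ ord q ≤ M) l (fun i => h i :: p)
        (fun i => (hSalong _ (hhS i)).1)
        (Interlaced.cons (P := fun _ => p) (G := 0) (by simp) (by simp))
      refine H M P hPI (fun i => (hP i).2) fun i j hij => ?_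
      simp only [(hP _).1, hhu] at hij
      exact Fin.ext (e.injective (Subtype.ext hij))

/-! ### Points of the cube -/

/-- The point of the cube whose coordinates are the counting function of `p`, in units `1 / k`. -/
noncomputable def point (k : ℕ) (p : List (ℕ → ℕ)) : Uinf :=
  ⟨BoundedContinuousFunction.ofNormedAddCommGroupDiscrete
    (fun j => min 1 ((cnt p j.unpair.1 j.unpair.2 : ℝ) / k)) 1 (fun j => by
      have : (0 : ℝ) ≤ (cnt p j.unpair.1 j.unpair.2 : ℝ) / k := by positivity
      rw [Real.norm_of_nonneg (le_min zero_le_one this)]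
      exact min_le_left _ _),
    fun j => ⟨le_min zero_le_one (by positivity), min_le_left _ _⟩⟩

lemma point_apply (k : ℕ) (p : List (ℕ → ℕ)) (j : ℕ) :
    (point k p : ℕ →ᵇ ℝ) j = min 1 ((cnt p j.unpair.1 j.unpair.2 : ℝ) / k) := rfl

lemma dist_point_le {ι : Type*} {P : ι → List (ℕ → ℕ)} (hP : Interlaced P) (k : ℕ) (i j : ι) :
    dist (point k (P i)) (point k (P j)) ≤ 1 / k := by
  obtain ⟨G, hG⟩ := hP
  rw [Subtype.dist_eq, BoundedContinuousFunction.dist_le (by positivity)]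
  intro n
  rw [point_apply, point_apply, Real.dist_eq]
  refine (abs_min_sub_min_le_max _ _ _ _).trans (max_le (by simp) ?_)
  rw [← sub_div, abs_div, Nat.abs_cast]
  gcongr
  have h1 : (cnt (P i) n.unpair.1 n.unpair.2 : ℝ) ≤ cnt (P j) n.unpair.1 n.unpair.2 + 1 :=
    mod_cast (hG i j n.unpair.1 n.unpair.2).1
  have h2 : (cnt (P j) n.unpair.1 n.unpair.2 : ℝ) ≤ cnt (P i) n.unpair.1 n.unpair.2 + 1 :=
    mod_cast (hG j i n.unpair.1 n.unpair.2).1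
  exact abs_le.2 ⟨by linarith, by linarith⟩

lemma one_le_dist_point {k : ℕ} (hk : 0 < k) {p q : List (ℕ → ℕ)} {c t : ℕ}
    (hp : cnt p c t = k) (hq : cnt q c t = 0) : 1 ≤ dist (point k p) (point k q) := by
  have h := BoundedContinuousFunction.dist_coe_le_dist (f := (point k p : ℕ →ᵇ ℝ))
    (g := (point k q : ℕ →ᵇ ℝ)) (Nat.pair c t)
  have hk' : (k : ℝ) ≠ 0 := by positivity
  simpa [point_apply, hp, hq, hk', Real.dist_eq, Subtype.dist_eq] using h

lemma dist_le_one (x y : Uinf) : dist x y ≤ 1 := by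
  rw [Subtype.dist_eq, BoundedContinuousFunction.dist_le zero_le_one]
  intro n
  have hx := x.2 n
  have hy := y.2 n
  rw [Real.dist_eq]
  exact abs_le.2 ⟨by linarith [hx.1, hy.2], by linarith [hx.2, hy.1]⟩

end InfinitaryLebesgue

open InfinitaryLebesgue in
theorem infinitary_lebesgue_covering
    (𝒰 : Set (Set ↥Uinf)) (hunif : IsUniformCover 𝒰)
    (hdiam : ∀ U ∈ 𝒰, Metric.diam U < 1) :
    ∃ x : ↥Uinf, {U ∈ 𝒰 | x ∈ U}.Infinite := by
  by_contra! hfin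
  obtain ⟨-, ε, hε, hleb⟩ := hunif
  have hball : ∀ x : Uinf, ∃ U ∈ 𝒰, Metric.closedBall x (ε / 4) ⊆ U := fun x =>
    hleb _ ((Metric.diam_closedBall (by positivity)).trans_lt (by linarith))
  choose U hU hsub using hball
  obtain ⟨k, hk⟩ := exists_nat_one_div_lt (show (0 : ℝ) < ε / 4 by positivity)
  obtain ⟨N, u, stems, hlen, halong⟩ := exists_along_const
    (fun p => U (point (k + 1) p))
    (fun p => {V ∈ 𝒰 | point (k + 1) p ∈ V}.ncard) (by
      intro N P hP hord hinj
      have hle := Set.ncard_le_ncard (s := Set.range fun i => U (point (k + 1) (P i)))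
        (t := {V ∈ 𝒰 | point (k + 1) (P 0) ∈ V}) (by
          rintro _ ⟨i, rfl⟩
          refine ⟨hU _, hsub _ (Metric.mem_closedBall.2 ?_)⟩
          refine (dist_point_le hP (k + 1) 0 i).trans ?_
          push_cast
          exact hk.le) (hfin _)
      rw [Set.ncard_range_of_injective hinj, Nat.card_eq_fintype_card, Fintype.card_fin] at hle
      have := hord 0
      omega) (k + 1) []
  obtain ⟨p, q, c, t, hp, hq, hpc, hqc⟩ := exists_separated halong
  have hself : ∀ x, x ∈ U x := fun x => hsub x (Metric.mem_closedBall_self (by positivity))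
  have hpu : point (k + 1) p ∈ u := hp.1 ▸ hself _
  have hqu : point (k + 1) q ∈ u := hq.1 ▸ hself _
  have hu : u ∈ 𝒰 := hp.1 ▸ hU _
  have hbdd : Bornology.IsBounded u :=
    Metric.isBounded_iff.2 ⟨1, fun x _ y _ => dist_le_one x y⟩
  have := Metric.dist_le_diam_of_mem hbdd hpu hqu
  have := one_le_dist_point k.succ_pos (hpc.trans hlen) hqc
  linarith [hdiam u hu]
end

section
/- Let n be a positive integer and let φ : [n]^ω → {0,1}^ω be a Sperner colouring. Then there exists σ ∈ [n]^ω such that the image φ(K_σ) is an infinite set. -/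
/-- The cube `K_σ` with index `σ ∈ [n]^ω`: all points `σ ⊕ τ` with `τ ∈ {0,1}^ω`,
where `(σ ⊕ τ)(i) = min (n, σ(i) + τ(i))`. -/
def cube (n : ℕ) (σ : ℕ → Fin (n + 1)) : Set (ℕ → Fin (n + 1)) :=
  {ρ | ∃ τ : ℕ → Bool, ∀ i, (ρ i : ℕ) = min n ((σ i : ℕ) + (if τ i then 1 else 0))}

/-- `φ : [n]^ω → {0,1}^ω` is a Sperner colouring: `φ σ ≠ φ σ'` whenever
`sup_i |σ(i) − σ'(i)| = n`, i.e. some coordinate takes the values `0` and `n`. -/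
def SpernerColouring {C : Type*} (n : ℕ) (φ : (ℕ → Fin (n + 1)) → C) : Prop :=
  ∀ σ σ' : ℕ → Fin (n + 1),
    (∃ i, ((σ i : ℕ) = 0 ∧ (σ' i : ℕ) = n) ∨ ((σ i : ℕ) = n ∧ (σ' i : ℕ) = 0)) →
    φ σ ≠ φ σ'

namespace InfinitarySperner

open Filter

/-- The sequence whose first entries are those of `u` and whose other entries are those of `x`. -/
def overwrite (u : List ℕ) (x : ℕ → ℕ) (i : ℕ) : ℕ :=
  if i < u.length then u.getD i 0 else x i

/-- The basic set of sequences extending `u` and lying above `h` beyond the length of `u`. -/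
def cone (u : List ℕ) (h : ℕ → ℕ) : Set (ℕ → ℕ) :=
  {γ | (∀ i < u.length, γ i = u.getD i 0) ∧ ∀ i, u.length ≤ i → h i ≤ γ i}

/-- The indicator function of the region lying strictly under the graph of `x`. -/
def under (x : ℕ → ℕ) (i h : ℕ) : ℕ := if h < x i then 1 else 0

lemma under_mono {x y : ℕ → ℕ} (hxy : x ≤ y) : under x ≤ under y := by
  intro i h
  have : x i ≤ y i := hxy i
  simp only [under]
  split_ifs <;> omega

lemma under_le_one (x : ℕ → ℕ) : under x ≤ 1 := by
  intro i h
  simp only [under, Pi.one_apply]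
  split_ifs <;> omega

lemma exists_eq_map_range (next : List ℕ → ℕ) :
    ∃ γ : ℕ → ℕ, ∀ i, γ i = next ((List.range i).map γ) := by
  let L : ℕ → List ℕ := fun i => Nat.rec [] (fun _ l => l ++ [next l]) i
  refine ⟨fun i => next (L i), fun i => ?_⟩
  have key : ∀ j, L j = (List.range j).map fun i => next (L i) := by
    intro j
    induction j with
    | zero => rfl
    | succ j ih =>
      rw [List.range_succ, List.map_append, ← ih]
      rfl
  exact congrArg next (key i)

/-- A countable colouring of the sequences has a colour class which is dominating
beyond some finite initial segment. -/
lemma exists_frequent_colour {κ : Type*} [Countable κ] (f : (ℕ → ℕ) → κ) :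
    ∃ u k, ∀ h, ∃ γ ∈ cone u h, f γ = k := by
  obtain ⟨e, he⟩ := exists_injective_nat κ
  suffices H : ∃ u k, ∀ h, ∃ γ ∈ cone u h, e (f γ) = k by
    obtain ⟨u, k, hk⟩ := H
    obtain ⟨γ₀, -, hγ₀⟩ := hk 0
    refine ⟨u, f γ₀, fun h => ?_⟩
    obtain ⟨γ, hγ, hγk⟩ := hk h
    exact ⟨γ, hγ, he (hγk.trans hγ₀.symm)⟩
  by_contra! hcon
  choose h hh using hcon
  obtain ⟨γ, hγ⟩ := exists_eq_map_range fun l =>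
    (Finset.range (l.length + 1)).sup fun k => h (l.take k) k l.length
  refine hh ((List.range (e (f γ))).map γ) (e (f γ)) γ ⟨?_, ?_⟩ rfl
  · intro i hi
    rw [List.length_map, List.length_range] at hi
    simp [List.getD, hi]
  · intro i hi
    rw [List.length_map, List.length_range] at hi
    rw [hγ i]
    have := Finset.le_sup (f := fun k => h (((List.range i).map γ).take k) k i)
      (Finset.mem_range.2 (Nat.lt_succ_of_le hi))
    simpa [← List.map_take, List.take_range, Nat.min_eq_left hi] using this

/-- `Recurs E us b`: the property `E` holds of `b` plus a sum of functions `under γ`, the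
sequences `γ` being chosen successively, each as an extension of the corresponding list in `us`
which is as large as desired. -/
def Recurs (E : (ℕ → ℕ → ℕ) → Prop) : List (List ℕ) → (ℕ → ℕ → ℕ) → Prop
  | [], b => E b
  | u :: us, b => ∀ h, ∃ γ ∈ cone u h, Recurs E us (b + under γ)

lemma exists_recurs {κ : Type*} [Countable κ] (f : (ℕ → ℕ → ℕ) → κ) (m : ℕ) (b : ℕ → ℕ → ℕ) :
    ∃ us : List (List ℕ), us.length = m ∧ ∃ N, Recurs (fun b => f b = N) us b := by
  induction m generalizing b with
  | zero => exact ⟨[], rfl, f b, rfl⟩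
  | succ m ih =>
    choose us hus N hN using fun γ => ih (b + under γ)
    obtain ⟨u, ⟨vs, M⟩, h⟩ := exists_frequent_colour fun γ => (us γ, N γ)
    obtain ⟨γ₀, -, hγ₀⟩ := h 0
    simp only [Prod.mk.injEq] at h hγ₀
    refine ⟨u :: vs, by rw [List.length_cons, ← hγ₀.1, hus], M, fun g => ?_⟩
    obtain ⟨γ, hγ, rfl, rfl⟩ := h g
    exact ⟨γ, hγ, hN γ⟩

lemma Recurs.imp {E F : (ℕ → ℕ → ℕ) → Prop} (hEF : ∀ b, E b → F b) {us : List (List ℕ)}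
    {b : ℕ → ℕ → ℕ} (h : Recurs E us b) : Recurs F us b := by
  induction us generalizing b with
  | nil => exact hEF b h
  | cons u us ih =>
    intro g
    obtain ⟨γ, hγ, hr⟩ := h g
    exact ⟨γ, hγ, ih hr⟩

lemma add_under_mem_Icc {u : List ℕ} {X Y γ x : ℕ → ℕ} {a b : ℕ → ℕ → ℕ}
    (ha : a ∈ Set.Icc b (b + under X)) (hγ : γ ∈ cone u X) (hx : γ ≤ x) (hXY : X ≤ Y)
    (hxY : x ≤ Y) :
    a + under (overwrite u x) ∈ Set.Icc (b + under γ) (b + under γ + under Y) := by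
  refine ⟨fun i h => ?_, fun i h => ?_⟩
  all_goals
    have h₁ := ha.1 i h
    have h₂ := ha.2 i h
    have h₃ := hγ.1 i
    have h₄ := hγ.2 i
    have h₅ := hx i
    have h₆ := hXY i
    have h₇ := hxY i
    simp only [Pi.add_apply, under, overwrite] at *
    by_cases hi : i < u.length
    · have := h₃ hi
      simp only [hi, if_true] at *
      split_ifs at * <;> omega
    · have := h₄ (not_lt.1 hi)
      simp only [hi, if_false] at *
      split_ifs at * <;> omega

/-- An ultrafilter on the sequences of natural numbers containing all the sets `Set.Ici h`. -/
noncomputable def dominating : Ultrafilter (ℕ → ℕ) := Ultrafilter.of atTop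

lemma eventually_ge_dominating (h : ℕ → ℕ) : ∀ᶠ x in dominating, h ≤ x :=
  Ultrafilter.of_le (f := (atTop : Filter (ℕ → ℕ))) (eventually_ge_atTop h)

section Limit

variable {C : Type*} [Nonempty C]

/-- The iterated limit of the colouring `ψ` along the ultrafilter `dominating`, one limit being
taken for each element of the list. -/
noncomputable def limitColour (ψ : (ℕ → ℕ → ℕ) → C) : List (List ℕ) → (ℕ → ℕ → ℕ) → C
  | [], a => ψ a
  | u :: us, a => Classical.epsilon fun k =>
      ∀ᶠ x in dominating, limitColour ψ us (a + under (overwrite u x)) = k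

lemma eventually_eq_epsilon {α : Type*} (F : Ultrafilter α) {s : Set α} (hs : s ∈ F) (g : α → C)
    {N : ℕ} (hN : ∀ T : Finset C, ↑T ⊆ g '' s → T.card ≤ N) :
    ∀ᶠ x in F, g x = Classical.epsilon fun k => ∀ᶠ x in F, g x = k := by
  have hfin : (g '' s).Finite := by
    by_contra hinf
    obtain ⟨T, hT, hcard⟩ := Set.Infinite.exists_subset_card_eq hinf (N + 1)
    have := hN T hT
    omega
  refine Classical.epsilon_spec (p := fun k => ∀ᶠ x in F, g x = k) ?_
  have hex : ∀ᶠ x in F, ∃ k ∈ g '' s, g x = k :=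
    Filter.mem_of_superset hs fun x hx => ⟨g x, ⟨x, hx, rfl⟩, rfl⟩
  obtain ⟨k, -, hk⟩ := (Ultrafilter.eventually_exists_mem_iff hfin).1 hex
  exact ⟨k, hk⟩

/-- `b` has at most `N` colours above it. -/
def FewColours (ψ : (ℕ → ℕ → ℕ) → C) (N : ℕ) (b : ℕ → ℕ → ℕ) : Prop :=
  ∀ T : Finset C, ↑T ⊆ ψ '' Set.Icc b (b + 1) → T.card ≤ N

variable {ψ : (ℕ → ℕ → ℕ) → C} {N : ℕ}

lemma eventually_limitColour_eq_of_bound {u : List ℕ} {us : List (List ℕ)} {X γ : ℕ → ℕ}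
    {a b : ℕ → ℕ → ℕ} (ha : a ∈ Set.Icc b (b + under X)) (hγ : γ ∈ cone u X)
    (hN : ∀ Y, ∀ T : Finset C,
      ↑T ⊆ limitColour ψ us '' Set.Icc (b + under γ) (b + under γ + under Y) → T.card ≤ N) :
    ∀ᶠ x in dominating,
      limitColour ψ us (a + under (overwrite u x)) = limitColour ψ (u :: us) a := by
  refine eventually_eq_epsilon (N := N) dominating (eventually_ge_dominating γ) _ fun T hT => ?_
  choose! x hx hxk using fun k (hk : k ∈ T) => hT hk
  refine hN (X + ∑ k ∈ T, x k) T fun k hk => ⟨_, add_under_mem_Icc ha hγ (hx k hk) ?_ ?_, hxk k hk⟩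
  · exact le_self_add
  · exact (Finset.single_le_sum (f := x) (fun _ _ => zero_le) hk).trans le_add_self

lemma Recurs.card_le {us : List (List ℕ)} {b : ℕ → ℕ → ℕ} (h : Recurs (FewColours ψ N) us b)
    (X : ℕ → ℕ) (T : Finset C) (hT : ↑T ⊆ limitColour ψ us '' Set.Icc b (b + under X)) :
    T.card ≤ N := by
  induction us generalizing b X T with
  | nil =>
    refine h T (hT.trans (Set.image_mono (Set.Icc_subset_Icc_right ?_)))
    exact add_le_add_right (under_le_one X) b
  | cons u us ih =>
    obtain ⟨γ, hγ, hr⟩ := h X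
    choose! a ha hak using fun k (hk : k ∈ T) => hT hk
    have hev : ∀ᶠ x in dominating, ∀ k ∈ T,
        limitColour ψ us (a k + under (overwrite u x)) = limitColour ψ (u :: us) (a k) :=
      (Filter.eventually_all_finset T).2 fun k hk =>
        eventually_limitColour_eq_of_bound (ha k hk) hγ fun Y S hS => ih hr Y S hS
    obtain ⟨x, hx, hγx⟩ := (hev.and (eventually_ge_dominating γ)).exists
    exact ih hr (X + x) T fun k hk =>
      ⟨_, add_under_mem_Icc (ha k hk) hγ hγx le_self_add le_add_self, (hx k hk).trans (hak k hk)⟩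

lemma exists_colour_eq_limitColour {us : List (List ℕ)} {b a : ℕ → ℕ → ℕ} {X : ℕ → ℕ}
    (h : Recurs (FewColours ψ N) us b) (ha : a ∈ Set.Icc b (b + under X)) {i₀ : ℕ}
    (hi₀ : ∀ u ∈ us, u.length ≤ i₀) (H : ℕ) :
    ∃ a', ψ a' = limitColour ψ us a ∧ (∀ h < H, a' i₀ h = a i₀ h + us.length) ∧
      ∃ H', ∀ h, H' ≤ h → a' i₀ h = a i₀ h := by
  induction us generalizing a b X with
  | nil => exact ⟨a, rfl, by simp, 0, by simp⟩
  | cons u us ih =>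
    obtain ⟨γ, hγ, hr⟩ := h X
    have hev := eventually_limitColour_eq_of_bound ha hγ fun Y S hS => hr.card_le Y S hS
    obtain ⟨x, ⟨hx, hγx⟩, hHx⟩ := ((hev.and (eventually_ge_dominating γ)).and
      (eventually_ge_dominating fun _ => H)).exists
    obtain ⟨a', ha', hlt, H', hge⟩ := ih hr
      (add_under_mem_Icc ha hγ hγx (Y := X + x) le_self_add le_add_self)
      fun v hv => hi₀ v (List.mem_cons_of_mem u hv)
    have hu : ¬ i₀ < u.length := not_lt.2 (hi₀ u List.mem_cons_self)
    have hval : ∀ h, (a + under (overwrite u x)) i₀ h = a i₀ h + if h < x i₀ then 1 else 0 := by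
      intro h
      simp [under, overwrite, hu]
    refine ⟨a', ha'.trans hx, fun h hh => ?_, max H' (x i₀), fun h hh => ?_⟩
    · rw [hlt h hh, hval, if_pos (hh.trans_le (hHx i₀)), List.length_cons]
      omega
    · rw [hge h ((le_max_left _ _).trans hh), hval, if_neg (not_lt.2 ((le_max_right _ _).trans hh)),
        add_zero]

/-- The limit colours `limitColour ψ us (under x)` are eventually constant, which yields two
functions of the same colour whose values differ by at least `us.length + 1` at some place. -/
lemma exists_same_colour {us : List (List ℕ)} (h : Recurs (FewColours ψ N) us 0) :
    ∃ a a' : ℕ → ℕ → ℕ, ψ a = ψ a' ∧ ∃ i j, a i j = 0 ∧ a' i j = us.length + 1 := by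
  have hmem : ∀ x : ℕ → ℕ, under x ∈ Set.Icc (0 : ℕ → ℕ → ℕ) (0 + under x) :=
    fun x => ⟨fun _ _ => Nat.zero_le _, by rw [zero_add]⟩
  have hev := eventually_eq_epsilon (N := N) dominating Filter.univ_mem
    (fun x => limitColour ψ us (under x)) (fun T hT => by
      choose! x _ hxk using fun k (hk : k ∈ T) => hT hk
      refine h.card_le (∑ k ∈ T, x k) T fun k hk => ⟨_, ⟨(hmem _).1, ?_⟩, hxk k hk⟩
      rw [zero_add]
      exact under_mono (Finset.single_le_sum (f := x) (fun _ _ => zero_le) hk))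
  set c := Classical.epsilon fun k => ∀ᶠ x in dominating, limitColour ψ us (under x) = k
  obtain ⟨i₀, hi₀⟩ : ∃ i₀, ∀ u ∈ us, u.length ≤ i₀ :=
    ⟨(us.map List.length).sum, fun u hu => List.le_sum_of_mem (List.mem_map_of_mem hu)⟩
  obtain ⟨x, hx⟩ := hev.exists
  obtain ⟨a, hac, -, H, hH⟩ := exists_colour_eq_limitColour h (hmem x) hi₀ 0
  obtain ⟨y, hy, hHy⟩ :=
    (hev.and (eventually_ge_dominating fun _ => max H (x i₀) + 1)).exists
  obtain ⟨a', hac', hlt, -⟩ := exists_colour_eq_limitColour h (hmem y) hi₀ (max H (x i₀) + 1)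
  refine ⟨a, a', (hac.trans hx).trans (hac'.trans hy).symm, i₀, max H (x i₀), ?_, ?_⟩
  · rw [hH _ (le_max_left _ _), under, if_neg (not_lt.2 (le_max_right _ _))]
  · rw [hlt _ (Nat.lt_succ_self _), under, if_pos (Nat.lt_of_succ_le (hHy i₀)), add_comm]

end Limit

/-- The point of `[n]^ω` obtained by truncating `b` at `n` and enumerating `ℕ × ℕ`. -/
def point (n : ℕ) (b : ℕ → ℕ → ℕ) (j : ℕ) : Fin (n + 1) :=
  ⟨min n (b j.unpair.1 j.unpair.2), Nat.lt_succ_of_le (min_le_left _ _)⟩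

lemma point_mem_cube (n : ℕ) {a b : ℕ → ℕ → ℕ} (h : a ∈ Set.Icc b (b + 1)) :
    point n a ∈ cube n (point n b) := by
  refine ⟨fun j => decide (a j.unpair.1 j.unpair.2 ≠ b j.unpair.1 j.unpair.2), fun j => ?_⟩
  have h₁ := h.1 j.unpair.1 j.unpair.2
  have h₂ := h.2 j.unpair.1 j.unpair.2
  simp only [point, decide_eq_true_eq, Pi.add_apply, Pi.one_apply] at *
  split_ifs <;> omega

end InfinitarySperner

open InfinitarySperner

theorem infinitary_sperner (n : ℕ) (hn : 0 < n)
    (φ : (ℕ → Fin (n + 1)) → (ℕ → Bool)) (hφ : SpernerColouring n φ) :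
    ∃ σ : ℕ → Fin (n + 1), (φ '' cube n σ).Infinite := by
  by_contra! hfin
  obtain ⟨us, hus, N, hN⟩ := exists_recurs (fun b => (φ '' cube n (point n b)).ncard) (n - 1) 0
  have hr : Recurs (FewColours (fun a => φ (point n a)) N) us 0 := by
    refine hN.imp fun b hb T hT => ?_
    rw [← hb, ← Set.ncard_coe_finset]
    refine Set.ncard_le_ncard (hT.trans ?_) (hfin _)
    rintro _ ⟨a, ha, rfl⟩
    exact ⟨_, point_mem_cube n ha, rfl⟩
  obtain ⟨a, a', haa', i, j, h0, h1⟩ := exists_same_colour hr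
  refine hφ (point n a) (point n a') ⟨Nat.pair i j, Or.inl ⟨?_, ?_⟩⟩ haa'
  · simp [point, h0]
  · simp only [point, Nat.unpair_pair, h1]
    omega
end

section
/- Let 𝒰 be a uniform cover of U(c₀) such that diam(U) < 1 for every U ∈ 𝒰. Then there exists a sequence U_1, U_2, U_3, … of pairwise distinct members of 𝒰 such that U_1 ∩ U_2 ∩ ⋯ ∩ U_k ≠ ∅ for every k; in particular, no such cover is Noetherian. -/
open BoundedContinuousFunction

/-- The unit cube of `c₀`: bounded functions `ℕ → ℝ` with all values in `[0,1]` tending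
to `0` at infinity, with the supremum metric (inherited from `ℕ →ᵇ ℝ`). -/
def Uc0 : Set (ℕ →ᵇ ℝ) :=
  {x | (∀ i, x i ∈ Set.Icc (0 : ℝ) 1) ∧ Filter.Tendsto x Filter.atTop (nhds 0)}

/-- A cover is Noetherian if there is no infinite sequence of pairwise distinct members
all of whose finite initial intersections are nonempty. -/
def IsNoetherianCover {X : Type*} (𝒱 : Set (Set X)) : Prop :=
  ¬ ∃ V : ℕ → Set X, Function.Injective V ∧ (∀ k, V k ∈ 𝒱) ∧
      ∀ k, (⋂ i ∈ Finset.range (k + 1), V i).Nonempty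

/-- A real sequence with values in `[0,1]` that is eventually at most `t`. -/
def EventuallyBelow (t : ℝ) (x : ℕ → ℝ) : Prop :=
  (∀ i, x i ∈ Set.Icc (0 : ℝ) 1) ∧ ∀ᶠ i in Filter.atTop, x i ≤ t

/-- There is an infinite sequence of pairwise distinct members of `𝒰` all of whose finite
initial intersections are nonempty. -/
def HasMeetingSequence {X : Type*} (𝒰 : Set (Set X)) : Prop :=
  ∃ U : ℕ → Set X, Function.Injective U ∧ (∀ k, U k ∈ 𝒰) ∧
    ∀ k, (⋂ i ∈ Finset.range (k + 1), U i).Nonempty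

/-- The sequence equal to `1` before `d` and to `t` from `d` on. -/
noncomputable def stepSeq (t : ℝ) (d : ℕ) (i : ℕ) : ℝ := if i < d then 1 else t

theorem exists_uc0_eq {x : ℕ → ℝ} (hx : EventuallyBelow 0 x) : ∃ y : Uc0, ∀ i, y.1 i = x i := by
  obtain ⟨h01, hev⟩ := hx
  refine ⟨⟨BoundedContinuousFunction.ofNormedAddCommGroup x continuous_of_discreteTopology 1
    fun i => ?_, h01, ?_⟩, fun i => rfl⟩
  · rw [Real.norm_eq_abs, abs_le]
    constructor <;> linarith [(h01 i).1, (h01 i).2]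
  · refine tendsto_const_nhds.congr' ?_
    filter_upwards [hev] with i hi
    exact le_antisymm (h01 i).1 hi

theorem uc0_isBounded (S : Set Uc0) : Bornology.IsBounded S := by
  refine Metric.isBounded_iff.2 ⟨1, fun x _ y _ => ?_⟩
  refine (BoundedContinuousFunction.dist_le zero_le_one).2 fun i => ?_
  have hx := x.2.1 i
  have hy := y.2.1 i
  rw [Real.dist_eq, abs_le]
  constructor <;> linarith [hx.1, hx.2, hy.1, hy.2]

theorem abs_sub_le_diam {S : Set Uc0} {x y : Uc0} (hx : x ∈ S) (hy : y ∈ S) (i : ℕ) :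
    |x.1 i - y.1 i| ≤ Metric.diam S :=
  (BoundedContinuousFunction.dist_coe_le_dist (f := x.1) (g := y.1) i).trans
    (Metric.dist_le_diam_of_mem (uc0_isBounded S) hx hy)

theorem EventuallyBelow.inf {s t : ℝ} {x c : ℕ → ℝ} (hx : EventuallyBelow t x)
    (hc0 : ∀ i, 0 ≤ c i) (hc : ∀ᶠ i in Filter.atTop, c i ≤ s) : EventuallyBelow s (x ⊓ c) :=
  ⟨fun i => ⟨le_inf (hx.1 i).1 (hc0 i), inf_le_left.trans (hx.1 i).2⟩,
    hc.mono fun _ h => inf_le_right.trans h⟩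

theorem stepSeq_nonneg {t : ℝ} (ht : 0 ≤ t) (d i : ℕ) : 0 ≤ stepSeq t d i := by
  unfold stepSeq; split_ifs <;> linarith

theorem stepSeq_of_lt (t : ℝ) {d i : ℕ} (h : i < d) : stepSeq t d i = 1 := if_pos h

theorem stepSeq_of_le (t : ℝ) {d i : ℕ} (h : d ≤ i) : stepSeq t d i = t := if_neg h.not_gt

theorem stepSeq_eventually_le (t : ℝ) (d : ℕ) : ∀ᶠ i in Filter.atTop, stepSeq t d i ≤ t :=
  (Filter.eventually_ge_atTop d).mono fun _ h => (stepSeq_of_le t h).le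

/-- `Φ` extends the assignment `G` to sequences eventually below `t` in such a way that on each
finite set it agrees with `G` evaluated at suitable common truncations. -/
def IsTruncationLimit {X : Type*} (G Φ : (ℕ → ℝ) → Set X) (t : ℝ) : Prop :=
  ∀ F : Finset (ℕ → ℝ), (∀ x ∈ F, EventuallyBelow t x) → ∀ D : ℕ,
    ∃ c : ℕ → ℝ, (∀ i, 0 ≤ c i) ∧ (∀ i < D, 1 ≤ c i) ∧ (∀ᶠ i in Filter.atTop, c i ≤ 0) ∧
      ∀ x ∈ F, Φ x = G (x ⊓ c)

theorem isTruncationLimit_self {X : Type*} (G : (ℕ → ℝ) → Set X) : IsTruncationLimit G G 0 := by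
  intro F hF D
  have hev : ∀ᶠ d in Filter.atTop, ∀ x ∈ F, ∀ i ≥ d, x i ≤ 0 :=
    (Filter.eventually_all_finset F).2 fun x hx => Filter.eventually_forall_ge_atTop.2 (hF x hx).2
  obtain ⟨d, hd, hDd⟩ := (hev.and (Filter.eventually_ge_atTop D)).exists
  refine ⟨stepSeq 0 d, stepSeq_nonneg le_rfl d,
    fun i hi => (stepSeq_of_lt 0 (hi.trans_le hDd)).ge, stepSeq_eventually_le 0 d, ?_⟩
  intro x hx
  congr 1
  refine (inf_eq_left.2 fun i => ?_).symm
  rcases lt_or_ge i d with h | h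
  · rw [stepSeq_of_lt 0 h]; exact ((hF x hx).1 i).2
  · rw [stepSeq_of_le 0 h]; exact hd x hx i h

/-- In the absence of meeting sequences, only finitely many sets are assigned to the truncations
of a sequence eventually below `t + δ` at level `t`. -/
theorem finite_truncation_values {𝒰 : Set (Set Uc0)} (h𝒰 : ¬ HasMeetingSequence 𝒰)
    {G Φ : (ℕ → ℝ) → Set Uc0} {δ t : ℝ} (hδ : 0 ≤ δ) (ht : 0 ≤ t)
    (hG : ∀ x, EventuallyBelow 0 x → G x ∈ 𝒰 ∧ ∀ y : Uc0, (∀ i, |y.1 i - x i| ≤ δ) → y ∈ G x)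
    (hΦ : IsTruncationLimit G Φ t) {x : ℕ → ℝ} (hx : EventuallyBelow (t + δ) x) :
    ∃ d₀, ((fun d => Φ (x ⊓ stepSeq t d)) '' Set.Ici d₀).Finite := by
  obtain ⟨d₀, hd₀⟩ := Filter.eventually_atTop.1 hx.2
  refine ⟨d₀, ?_⟩
  have htrunc : ∀ d, EventuallyBelow t (x ⊓ stepSeq t d) := fun d =>
    hx.inf (stepSeq_nonneg ht d) (stepSeq_eventually_le t d)
  by_contra hinf
  let V := Set.Infinite.natEmbedding _ hinf
  choose d hd hdV using fun k => (V k).2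
  refine h𝒰 ⟨fun k => (V k).1, Subtype.val_injective.comp V.injective, fun k => ?_, fun k => ?_⟩
  · obtain ⟨c, hc0, -, hc, hcΦ⟩ := hΦ {x ⊓ stepSeq t (d k)} (by simpa using htrunc (d k)) 0
    beta_reduce
    rw [← hdV k]
    simp only [hcΦ _ (Finset.mem_singleton_self _)]
    exact (hG _ ((htrunc _).inf hc0 hc)).1
  · classical
    obtain ⟨c, hc0, -, hc, hcΦ⟩ :=
      hΦ ((Finset.range (k + 1)).image fun j => x ⊓ stepSeq t (d j))
        (by simpa using fun j _ => htrunc (d j)) 0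
    obtain ⟨y, hy⟩ := exists_uc0_eq ((htrunc d₀).inf hc0 hc)
    refine ⟨y, Set.mem_iInter₂.2 fun j hj => ?_⟩
    beta_reduce
    rw [← hdV j]
    simp only [hcΦ _ (Finset.mem_image_of_mem _ hj)]
    refine (hG _ ((htrunc _).inf hc0 hc)).2 y fun i => ?_
    rw [hy i]
    refine (abs_inf_sub_inf_le_abs _ _ _).trans ?_
    rcases lt_or_ge i d₀ with h | h
    · simp only [Pi.inf_apply, stepSeq_of_lt t h, stepSeq_of_lt t (h.trans_le (hd j)), sub_self,
        abs_zero, hδ]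
    · have hxi := hd₀ i h
      simp only [Pi.inf_apply, stepSeq_of_le t h]
      rcases lt_or_ge i (d j) with h' | h'
      · rw [stepSeq_of_lt t h', inf_eq_left.2 (hx.1 i).2, abs_le]
        constructor <;> rcases min_cases (x i) t with hm | hm <;> linarith [hm.1, hm.2]
      · rw [stepSeq_of_le t h', sub_self, abs_zero]
        exact hδ

theorem IsTruncationLimit.exists_step {X : Type*} {G Φ : (ℕ → ℝ) → Set X} {s t : ℝ} (ht : 0 ≤ t)
    (hΦ : IsTruncationLimit G Φ t)
    (hfin : ∀ x, EventuallyBelow s x →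
      ∃ d₀, ((fun d => Φ (x ⊓ stepSeq t d)) '' Set.Ici d₀).Finite) :
    ∃ Ψ, IsTruncationLimit G Ψ s := by
  have hlim : ∀ x, ∃ V, EventuallyBelow s x →
      ∀ᶠ d in (Filter.hyperfilter ℕ : Filter ℕ), Φ (x ⊓ stepSeq t d) = V := by
    intro x
    by_cases hx : EventuallyBelow s x
    · obtain ⟨d₀, hd₀⟩ := hfin x hx
      have hge : ∀ᶠ d in (Filter.hyperfilter ℕ : Filter ℕ), d₀ ≤ d :=
        Nat.hyperfilter_le_atTop (Filter.eventually_ge_atTop d₀)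
      have hmem : ∀ᶠ d in (Filter.hyperfilter ℕ : Filter ℕ),
          ∃ V ∈ (fun d => Φ (x ⊓ stepSeq t d)) '' Set.Ici d₀, Φ (x ⊓ stepSeq t d) = V :=
        hge.mono fun d hd => ⟨_, Set.mem_image_of_mem _ hd, rfl⟩
      obtain ⟨V, -, hV⟩ := (Ultrafilter.eventually_exists_mem_iff hd₀).1 hmem
      exact ⟨V, fun _ => hV⟩
    · exact ⟨∅, fun h => absurd h hx⟩
  choose Ψ hΨ using hlim
  refine ⟨Ψ, fun F hF D => ?_⟩
  have hev : ∀ᶠ d in (Filter.hyperfilter ℕ : Filter ℕ), ∀ x ∈ F, Φ (x ⊓ stepSeq t d) = Ψ x :=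
    (Filter.eventually_all_finset F).2 fun x hx => hΨ x (hF x hx)
  have hge : ∀ᶠ d in (Filter.hyperfilter ℕ : Filter ℕ), D ≤ d :=
    Nat.hyperfilter_le_atTop (Filter.eventually_ge_atTop D)
  obtain ⟨d, hd, hDd⟩ := (hev.and hge).exists
  classical
  obtain ⟨c, hc0, hcD, hc, hcΦ⟩ := hΦ (F.image fun x => x ⊓ stepSeq t d) (by
    simpa using fun x hx => (hF x hx).inf (stepSeq_nonneg ht d) (stepSeq_eventually_le t d)) D
  refine ⟨stepSeq t d ⊓ c, fun i => le_inf (stepSeq_nonneg ht d i) (hc0 i),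
    fun i hi => le_inf (stepSeq_of_lt t (hi.trans_le hDd)).ge (hcD i hi),
    hc.mono fun i h => inf_le_right.trans h, fun x hx => ?_⟩
  rw [← hd x hx, hcΦ _ (Finset.mem_image_of_mem _ hx), inf_assoc]

theorem exists_isTruncationLimit {𝒰 : Set (Set Uc0)} (h𝒰 : ¬ HasMeetingSequence 𝒰)
    {G : (ℕ → ℝ) → Set Uc0} {δ : ℝ} (hδ : 0 ≤ δ)
    (hG : ∀ x, EventuallyBelow 0 x → G x ∈ 𝒰 ∧ ∀ y : Uc0, (∀ i, |y.1 i - x i| ≤ δ) → y ∈ G x)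
    (k : ℕ) : ∃ Φ, IsTruncationLimit G Φ (k * δ) := by
  induction k with
  | zero => exact ⟨G, by simpa using isTruncationLimit_self G⟩
  | succ k ih =>
    obtain ⟨Φ, hΦ⟩ := ih
    have ht : 0 ≤ k * δ := by positivity
    have hsucc : ((k + 1 : ℕ) : ℝ) * δ = k * δ + δ := by push_cast; ring
    rw [hsucc]
    exact hΦ.exists_step ht fun x hx => finite_truncation_values h𝒰 hδ ht hG hΦ hx

theorem IsUniformCover.exists_assignment {𝒰 : Set (Set Uc0)} (h : IsUniformCover 𝒰) :
    ∃ δ > (0 : ℝ), ∃ G : (ℕ → ℝ) → Set Uc0, ∀ x, EventuallyBelow 0 x →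
      G x ∈ 𝒰 ∧ ∀ y : Uc0, (∀ i, |y.1 i - x i| ≤ δ) → y ∈ G x := by
  obtain ⟨-, ε, hε, hcov⟩ := h
  have hsmall : ∀ x : ℕ → ℝ, ∃ U ∈ 𝒰, {y : Uc0 | ∀ i, |y.1 i - x i| ≤ ε / 3} ⊆ U := by
    refine fun x => hcov _ (lt_of_le_of_lt (Metric.diam_le_of_forall_dist_le
      (C := ε / 3 + ε / 3) (by positivity) fun y hy z hz => ?_) (by linarith))
    refine (BoundedContinuousFunction.dist_le (by positivity)).2 fun i => ?_
    refine (dist_triangle_right _ _ (x i)).trans (add_le_add ?_ ?_)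
    · exact hy i
    · exact hz i
  choose G hG using hsmall
  exact ⟨ε / 3, by positivity, G, fun x _ => ⟨(hG x).1, fun y hy => (hG x).2 hy⟩⟩

theorem hasMeetingSequence_of_isUniformCover {𝒰 : Set (Set Uc0)} (hunif : IsUniformCover 𝒰)
    (hdiam : ∀ U ∈ 𝒰, Metric.diam U < 1) : HasMeetingSequence 𝒰 := by
  by_contra hno
  obtain ⟨δ, hδ, G, hG⟩ := hunif.exists_assignment
  obtain ⟨k, hk⟩ := exists_nat_ge (1 / δ)
  rw [div_le_iff₀ hδ] at hk
  obtain ⟨Φ, hΦ⟩ := exists_isTruncationLimit hno hδ.le hG k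
  have hone : EventuallyBelow (k * δ) 1 := ⟨fun i => by simp, .of_forall fun i => hk⟩
  have key : ∀ D : ℕ, ∃ y : Uc0, y ∈ Φ 1 ∧ Φ 1 ∈ 𝒰 ∧ (∀ i < D, y.1 i = 1) ∧
      ∀ᶠ i in Filter.atTop, y.1 i ≤ 0 := by
    intro D
    obtain ⟨c, hc0, hcD, hc, hcΦ⟩ := hΦ {1} (by simpa using hone) D
    have hb : EventuallyBelow 0 (1 ⊓ c) := hone.inf hc0 hc
    obtain ⟨y, hy⟩ := exists_uc0_eq hb
    rw [hcΦ 1 (Finset.mem_singleton_self _)]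
    refine ⟨y, (hG _ hb).2 y fun i => by simp [hy, hδ.le], (hG _ hb).1, fun i hi => ?_,
      hb.2.mono fun i h => (hy i).trans_le h⟩
    rw [hy i]
    exact inf_eq_left.2 (hcD i hi)
  obtain ⟨y, hyV, hV, -, hy⟩ := key 0
  obtain ⟨i, hi⟩ := hy.exists
  obtain ⟨z, hzV, -, hz, -⟩ := key (i + 1)
  have hdist := (abs_sub_le_diam hzV hyV i).trans_lt (hdiam _ hV)
  rw [hz i i.lt_succ_self] at hdist
  linarith [le_abs_self (1 - y.1 i)]

theorem c0_infinitary_lebesgue_covering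
    (𝒰 : Set (Set ↥Uc0)) (hunif : IsUniformCover 𝒰)
    (hdiam : ∀ U ∈ 𝒰, Metric.diam U < 1) :
    (∃ U : ℕ → Set ↥Uc0, Function.Injective U ∧ (∀ k, U k ∈ 𝒰) ∧
        ∀ k, (⋂ i ∈ Finset.range (k + 1), U i).Nonempty) ∧
      ¬ IsNoetherianCover 𝒰 := by
  have h := hasMeetingSequence_of_isUniformCover hunif hdiam
  exact ⟨h, not_not.2 h⟩
end

section
/- Let m and n be positive integers and let φ : [m]^n → {0,1}^n be a map such that φ(σ) ≠ φ(σ′) whenever there exists an index i with σ(i) = 0 and σ′(i) = m. Then there exists σ ∈ {0,1,…,m−1}^n such that the image φ({σ + τ : τ ∈ {0,1}^n}) has at least n + 1 elements. -/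
open Finset

/-- The `k`-th vertex of the Kuhn simplex with base point `σ` in which coordinate `i` is
incremented at step `ρ i`. -/
def kuhnVertex {n : ℕ} (s : (Fin n → ℕ) × (Fin n → ℕ)) (k : ℕ) : Fin n → ℕ :=
  fun i => s.1 i + if s.2 i < k then 1 else 0

/-- The Kuhn simplices triangulating `[0, m]^n`. -/
def kuhnSimplices (m n : ℕ) : Finset ((Fin n → ℕ) × (Fin n → ℕ)) :=
  {s ∈ Fintype.piFinset (fun _ => range m) ×ˢ Fintype.piFinset (fun _ => range n) |
    Function.Injective s.2}

lemma mem_kuhnSimplices {m n : ℕ} {s : (Fin n → ℕ) × (Fin n → ℕ)} :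
    s ∈ kuhnSimplices m n ↔
      (∀ i, s.1 i < m) ∧ (∀ i, s.2 i < n) ∧ Function.Injective s.2 := by
  simp [kuhnSimplices, and_assoc]

lemma exists_step_eq {m n : ℕ} {s : (Fin n → ℕ) × (Fin n → ℕ)} (hs : s ∈ kuhnSimplices m n)
    {k : ℕ} (hk : k < n) : ∃ i, s.2 i = k := by
  obtain ⟨-, h2, h3⟩ := mem_kuhnSimplices.1 hs
  have hinj : Function.Injective (fun i => (⟨s.2 i, h2 i⟩ : Fin n)) := fun i j h =>
    h3 (congrArg Fin.val h)
  obtain ⟨i, hi⟩ := (Finite.injective_iff_surjective.1 hinj) ⟨k, hk⟩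
  exact ⟨i, congrArg Fin.val hi⟩

/-- All labels `0, …, n` occur among `f 0, …, f n`. -/
def IsRainbow (n : ℕ) (f : ℕ → ℕ) : Prop :=
  ∀ c ≤ n, ∃ j ≤ n, f j = c

/-- All labels `0, …, n - 1` occur among `f 0, …, f n` with `f k` left out. -/
def IsDoor (n : ℕ) (f : ℕ → ℕ) (k : ℕ) : Prop :=
  ∀ c < n, ∃ j ≤ n, j ≠ k ∧ f j = c

lemma IsDoor.injOn {n k : ℕ} {f : ℕ → ℕ} (hk : k ≤ n) (h : IsDoor n f k) :
    Set.InjOn f ((range (n + 1)).erase k) := by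
  have hsub : range n ⊆ ((range (n + 1)).erase k).image f := by
    intro c hc
    obtain ⟨j, hj, hjk, hjc⟩ := h c (mem_range.1 hc)
    exact mem_image.2 ⟨j, by simp [hjk]; omega, hjc⟩
  have hcard : ((range (n + 1)).erase k).card = n := by
    rw [card_erase_of_mem (by simp; omega)]; simp
  apply card_image_iff.1
  apply le_antisymm card_image_le
  have := card_le_card hsub
  rw [card_range] at this
  omega

open Classical in
/-- A simplex has one door if it is rainbow, and zero or two doors otherwise. -/
lemma sum_isDoor (n : ℕ) (f : ℕ → ℕ) (hf : ∀ j, f j ≤ n) :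
    ∑ k ∈ range (n + 1), (if IsDoor n f k then (1 : ZMod 2) else 0) =
      if IsRainbow n f then 1 else 0 := by
  by_cases hex : ∃ k ≤ n, IsDoor n f k
  swap
  · have hr : ¬ IsRainbow n f := by
      intro hr
      obtain ⟨k, hk, hkn⟩ := hr n le_rfl
      refine hex ⟨k, hk, fun c hc => ?_⟩
      obtain ⟨j, hj, hjc⟩ := hr c hc.le
      exact ⟨j, hj, by rintro rfl; omega, hjc⟩
    rw [if_neg hr]
    refine sum_eq_zero fun k hk => if_neg fun hd => hex ⟨k, ?_, hd⟩
    have := mem_range.1 hk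
    omega
  obtain ⟨k, hk, hd⟩ := hex
  rcases (hf k).lt_or_eq with hlt | heq
  · obtain ⟨l, hl, hlk, hfl⟩ := hd (f k) hlt
    have hinj := hd.injOn hk
    have hr : ¬ IsRainbow n f := by
      intro hr
      have hsub : range (n + 1) ⊆ ((range (n + 1)).erase k).image f := by
        intro c hc
        obtain ⟨j, hj, hjc⟩ := hr c (by have := mem_range.1 hc; omega)
        by_cases hjk : j = k
        · exact mem_image.2 ⟨l, by simp [hlk]; omega, by rw [hfl, ← hjk, hjc]⟩
        · exact mem_image.2 ⟨j, by simp [hjk]; omega, hjc⟩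
      have h1 := card_le_card hsub
      have h2 := card_image_le (s := (range (n + 1)).erase k) (f := f)
      rw [card_erase_of_mem (by simp; omega)] at h2
      simp at h1 h2
      omega
    have hdl : IsDoor n f l := by
      intro c hc
      obtain ⟨j, hj, hjk, hjc⟩ := hd c hc
      by_cases hjl : j = l
      · exact ⟨k, hk, hlk.symm, by rw [← hfl, ← hjl, hjc]⟩
      · exact ⟨j, hj, hjl, hjc⟩
    have hothers : ∀ j ∈ range (n + 1), j ≠ k ∧ j ≠ l →
        (if IsDoor n f j then (1 : ZMod 2) else 0) = 0 := by
      rintro j hj ⟨hjk, hjl⟩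
      refine if_neg fun hdj => ?_
      obtain ⟨p, hp, hpj, hpc⟩ := hdj (f j) (by
        by_contra hjn
        have hjn' : f j = n := le_antisymm (hf j) (by omega)
        apply hr
        intro c hc
        rcases hc.lt_or_eq with hc | rfl
        · obtain ⟨q, hq, -, hqc⟩ := hd c hc
          exact ⟨q, hq, hqc⟩
        · exact ⟨j, by have := mem_range.1 hj; omega, hjn'⟩)
      by_cases hpk : p = k
      · refine hjl (hinj (by simpa [hjk] using hj) (by simp [hlk]; omega) ?_)
        rw [← hpc, hpk, hfl]
      · exact hpj (hinj (by simp [hpk]; omega) (by simpa [hjk] using hj) hpc)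
    rw [sum_eq_add_of_mem k l (by simp; omega) (by simp; omega) hlk.symm hothers,
      if_pos hd, if_pos hdl, if_neg hr]
    decide
  · have hr : IsRainbow n f := by
      intro c hc
      rcases hc.lt_or_eq with hc | rfl
      · obtain ⟨q, hq, -, hqc⟩ := hd c hc
        exact ⟨q, hq, hqc⟩
      · exact ⟨k, hk, heq⟩
    rw [if_pos hr, sum_eq_single_of_mem k (by simp; omega), if_pos hd]
    intro j hj hjk
    refine if_neg fun hdj => ?_
    have hjn : f j < n := by
      by_contra hjn
      have h1 : range (n + 1) ⊆ ((range (n + 1)).erase k).image f := by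
        intro c hc
        rcases (Nat.lt_succ_iff.1 (mem_range.1 hc)).lt_or_eq with hc | rfl
        · obtain ⟨q, hq, hqk, hqc⟩ := hd c hc
          exact mem_image.2 ⟨q, by simp [hqk]; omega, hqc⟩
        · exact mem_image.2 ⟨j, by simpa [hjk] using hj, le_antisymm (hf j) (by omega)⟩
      have h1 := card_le_card h1
      have h2 := card_image_le (s := (range (n + 1)).erase k) (f := f)
      rw [card_erase_of_mem (by simp; omega)] at h2
      simp at h1 h2
      omega
    obtain ⟨p, hp, hpj, hpc⟩ := hdj (f j) hjn
    by_cases hpk : p = k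
    · rw [hpk] at hpc; omega
    · exact hpj (hd.injOn hk (by simp [hpk]; omega) (by simpa [hjk] using hj) hpc)

/-- Exchange the steps `k` and `k + 1` of a Kuhn simplex. -/
def swapStep {n : ℕ} (k : ℕ) (s : (Fin n → ℕ) × (Fin n → ℕ)) : (Fin n → ℕ) × (Fin n → ℕ) :=
  (s.1, fun i => Equiv.swap k (k + 1) (s.2 i))

lemma kuhnVertex_swapStep {n k j : ℕ} (s : (Fin n → ℕ) × (Fin n → ℕ)) (hj : j ≠ k + 1) :
    kuhnVertex (swapStep k s) j = kuhnVertex s j := by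
  funext i
  simp only [kuhnVertex, swapStep, Equiv.swap_apply_def]
  split_ifs <;> omega

lemma swapStep_mem {m n k : ℕ} (hk : k + 1 < n) {s : (Fin n → ℕ) × (Fin n → ℕ)}
    (hs : s ∈ kuhnSimplices m n) : swapStep k s ∈ kuhnSimplices m n := by
  obtain ⟨h1, h2, h3⟩ := mem_kuhnSimplices.1 hs
  refine mem_kuhnSimplices.2 ⟨h1, fun i => ?_, (Equiv.injective _).comp h3⟩
  have := h2 i
  simp only [swapStep, Equiv.swap_apply_def]
  split_ifs <;> omega

open Classical in
lemma sum_isDoor_interior {m n k : ℕ} (hk : k + 1 < n) (l : (Fin n → ℕ) → ℕ) :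
    ∑ s ∈ kuhnSimplices m n,
      (if IsDoor n (fun j => l (kuhnVertex s j)) (k + 1) then (1 : ZMod 2) else 0) = 0 := by
  refine sum_involution (fun s _ => swapStep k s) ?_ ?_ (fun s hs => swapStep_mem hk hs) ?_
  · intro s _
    have : IsDoor n (fun j => l (kuhnVertex (swapStep k s) j)) (k + 1) ↔
        IsDoor n (fun j => l (kuhnVertex s j)) (k + 1) := by
      refine forall₂_congr fun c _ => exists_congr fun j => ?_
      refine and_congr_right fun _ => and_congr_right fun hj => ?_
      simp only [kuhnVertex_swapStep s hj]
    simp only [this]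
    exact CharTwo.add_self_eq_zero _
  · intro s hs _ h
    obtain ⟨i, hi⟩ := exists_step_eq hs (show k < n by omega)
    have := congrFun (congrArg Prod.snd h) i
    simp [swapStep, hi] at this
  · intro s _
    simp [swapStep]

/-- Remove the first vertex of a Kuhn simplex and extend it past its last vertex. -/
def rotate {d : ℕ} (s : (Fin (d + 1) → ℕ) × (Fin (d + 1) → ℕ)) :
    (Fin (d + 1) → ℕ) × (Fin (d + 1) → ℕ) :=
  (fun i => s.1 i + if s.2 i = 0 then 1 else 0, fun i => if s.2 i = 0 then d else s.2 i - 1)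

/-- Remove the last vertex of a Kuhn simplex and extend it before its first vertex. -/
def unrotate {d : ℕ} (s : (Fin (d + 1) → ℕ) × (Fin (d + 1) → ℕ)) :
    (Fin (d + 1) → ℕ) × (Fin (d + 1) → ℕ) :=
  (fun i => s.1 i - if s.2 i = d then 1 else 0, fun i => if s.2 i = d then 0 else s.2 i + 1)

lemma isDoor_rotate {m d : ℕ} {s : (Fin (d + 1) → ℕ) × (Fin (d + 1) → ℕ)}
    (hs : s ∈ kuhnSimplices m (d + 1)) (l : (Fin (d + 1) → ℕ) → ℕ) :
    IsDoor (d + 1) (fun j => l (kuhnVertex (rotate s) j)) (d + 1) ↔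
      IsDoor (d + 1) (fun j => l (kuhnVertex s j)) 0 := by
  have key : ∀ j ≤ d, kuhnVertex (rotate s) j = kuhnVertex s (j + 1) := by
    intro j hj
    funext i
    have := (mem_kuhnSimplices.1 hs).2.1 i
    simp only [kuhnVertex, rotate]
    split_ifs <;> omega
  refine forall₂_congr fun c _ => ⟨?_, ?_⟩
  · rintro ⟨j, hj, hjd, hjc⟩
    refine ⟨j + 1, by omega, by omega, ?_⟩
    simpa only [key j (by omega)] using hjc
  · rintro ⟨j, hj, hj0, hjc⟩
    obtain ⟨j, rfl⟩ := Nat.exists_eq_succ_of_ne_zero hj0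
    refine ⟨j, by omega, by omega, ?_⟩
    simpa only [key j (by omega)] using hjc

open Classical in
lemma sum_isDoor_rotate {m d : ℕ} (l : (Fin (d + 1) → ℕ) → ℕ) :
    ∑ s ∈ kuhnSimplices m (d + 1) with ¬ ∃ i, s.2 i = 0 ∧ s.1 i + 1 = m,
      (if IsDoor (d + 1) (fun j => l (kuhnVertex s j)) 0 then (1 : ZMod 2) else 0) =
    ∑ s ∈ kuhnSimplices m (d + 1) with ¬ ∃ i, s.2 i = d ∧ s.1 i = 0,
      (if IsDoor (d + 1) (fun j => l (kuhnVertex s j)) (d + 1) then (1 : ZMod 2) else 0) := by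
  refine sum_nbij' rotate unrotate ?_ ?_ ?_ ?_ ?_
  · intro s hs
    obtain ⟨hs, hb⟩ := mem_filter.1 hs
    obtain ⟨h1, h2, h3⟩ := mem_kuhnSimplices.1 hs
    push Not at hb
    refine mem_filter.2 ⟨mem_kuhnSimplices.2 ⟨fun i => ?_, fun i => ?_, fun i j hij => ?_⟩, ?_⟩
    · have := h1 i
      have := hb i
      simp only [rotate]
      split_ifs <;> omega
    · have := h2 i
      simp only [rotate]
      split_ifs <;> omega
    · have := h2 i
      have := h2 j
      apply h3
      simp only [rotate] at hij
      split_ifs at hij <;> omega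
    · rintro ⟨i, hi, hi'⟩
      have := h2 i
      simp only [rotate] at hi hi'
      split_ifs at hi hi' <;> omega
  · intro s hs
    obtain ⟨hs, hb⟩ := mem_filter.1 hs
    obtain ⟨h1, h2, h3⟩ := mem_kuhnSimplices.1 hs
    push Not at hb
    refine mem_filter.2 ⟨mem_kuhnSimplices.2 ⟨fun i => ?_, fun i => ?_, fun i j hij => ?_⟩, ?_⟩
    · have := h1 i
      simp only [unrotate]
      split_ifs <;> omega
    · have := h2 i
      simp only [unrotate]
      split_ifs <;> omega
    · have := h2 i
      have := h2 j
      apply h3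
      simp only [unrotate] at hij
      split_ifs at hij <;> omega
    · rintro ⟨i, hi, hi'⟩
      have := h1 i
      have := hb i
      simp only [unrotate] at hi hi'
      split_ifs at hi hi' <;> omega
  · intro s hs
    have h2 := (mem_kuhnSimplices.1 (mem_filter.1 hs).1).2.1
    refine Prod.ext (funext fun i => ?_) (funext fun i => ?_) <;>
    · have := h2 i
      simp only [rotate, unrotate]
      split_ifs <;> omega
  · intro s hs
    obtain ⟨hs, hb⟩ := mem_filter.1 hs
    have h2 := (mem_kuhnSimplices.1 hs).2.1
    push Not at hb
    refine Prod.ext (funext fun i => ?_) (funext fun i => ?_) <;>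
    · have := hb i
      have := h2 i
      by_cases h : s.2 i = d <;> simp [rotate, unrotate, h] <;> omega
  · intro s hs
    simp only [isDoor_rotate (mem_filter.1 hs).1 l]

/-- The Kuhn simplex of dimension `d + 1` standing on a Kuhn simplex of the facet
where the last coordinate vanishes. -/
def liftSimplex {d : ℕ} (s : (Fin d → ℕ) × (Fin d → ℕ)) :
    (Fin (d + 1) → ℕ) × (Fin (d + 1) → ℕ) :=
  (Fin.snoc (α := fun _ => ℕ) s.1 0, Fin.snoc (α := fun _ => ℕ) s.2 d)

lemma kuhnVertex_liftSimplex {d j : ℕ} (s : (Fin d → ℕ) × (Fin d → ℕ)) (hj : j ≤ d) :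
    kuhnVertex (liftSimplex s) j = Fin.snoc (α := fun _ => ℕ) (kuhnVertex s j) 0 := by
  funext i
  refine Fin.lastCases ?_ (fun i => ?_) i
  · simp [kuhnVertex, liftSimplex]
    omega
  · simp [kuhnVertex, liftSimplex]

open Classical in
lemma sum_isDoor_bottom {m d : ℕ} (hm : 0 < m) (l : (Fin (d + 1) → ℕ) → ℕ)
    (h0 : ∀ v (i : Fin (d + 1)), v i = 0 → l v ≤ i) :
    ∑ s ∈ kuhnSimplices m (d + 1) with ∃ i, s.2 i = d ∧ s.1 i = 0,
      (if IsDoor (d + 1) (fun j => l (kuhnVertex s j)) (d + 1) then (1 : ZMod 2) else 0) =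
    ∑ s ∈ kuhnSimplices m d,
      if IsRainbow d (fun j => l (Fin.snoc (α := fun _ => ℕ) (kuhnVertex s j) 0)) then 1
        else 0 := by
  symm
  refine sum_of_injOn liftSimplex ?_ ?_ ?_ ?_
  · intro s _ t _ hst
    refine Prod.ext ?_ ?_
    · exact (Fin.snoc_inj (α := fun _ => ℕ) |>.1 (congrArg Prod.fst hst)).1
    · exact (Fin.snoc_inj (α := fun _ => ℕ) |>.1 (congrArg Prod.snd hst)).1
  · intro s hs
    obtain ⟨h1, h2, h3⟩ := mem_kuhnSimplices.1 hs
    refine mem_filter.2 ⟨mem_kuhnSimplices.2 ⟨?_, ?_, ?_⟩, Fin.last d, ?_⟩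
    · intro i
      refine Fin.lastCases ?_ (fun i => ?_) i
      · simpa [liftSimplex] using hm
      · simpa [liftSimplex] using h1 i
    · intro i
      refine Fin.lastCases ?_ (fun i => ?_) i
      · simp [liftSimplex]
      · simpa [liftSimplex] using (h2 i).trans (Nat.lt_succ_self d)
    · refine Fin.snoc_injective_iff.2 ⟨h3, ?_⟩
      rintro ⟨i, hi⟩
      have := h2 i
      omega
    · simp [liftSimplex]
  · intro s hs hns
    obtain ⟨hs, i, hid, hi0⟩ := mem_filter.1 hs
    obtain ⟨h1, h2, h3⟩ := mem_kuhnSimplices.1 hs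
    refine if_neg fun hd => hns ?_
    have hi : i = Fin.last d := by
      obtain ⟨j, hj, hjd, hjc⟩ := hd d (by omega)
      have := h0 (kuhnVertex s j) i (by simp only [kuhnVertex]; split_ifs <;> omega)
      simp only at hjc
      refine Fin.ext ?_
      have := i.2
      rw [Fin.val_last]
      omega
    subst hi
    refine ⟨(Fin.init s.1, Fin.init s.2), mem_kuhnSimplices.2 ⟨fun i => h1 _, fun i => ?_, ?_⟩, ?_⟩
    · have h := h2 i.castSucc
      have : s.2 i.castSucc ≠ d := fun h => by
        have := h3 (h.trans hid.symm)
        exact absurd this (Fin.castSucc_lt_last i).ne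
      simp only [Fin.init]
      omega
    · intro a b hab
      exact Fin.castSucc_injective d (h3 hab)
    · refine Prod.ext ?_ ?_
      · simp only [liftSimplex]
        rw [← hi0, Fin.snoc_init_self]
      · simp only [liftSimplex]
        conv_rhs => rw [← Fin.snoc_init_self s.2, hid]
  · intro s _
    refine if_congr ?_ rfl rfl
    refine ⟨fun h c hc => ?_, fun h c hc => ?_⟩
    · obtain ⟨j, hj, hjc⟩ := h c (by omega)
      exact ⟨j, by omega, by omega, by simpa only [kuhnVertex_liftSimplex s hj] using hjc⟩
    · obtain ⟨j, hj, hjd, hjc⟩ := h c (by omega)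
      have hj : j ≤ d := by omega
      exact ⟨j, hj, by simpa only [kuhnVertex_liftSimplex s hj] using hjc⟩

open Classical in
/-- The **Kuhn cubical Sperner lemma**, counting form: the number of rainbow Kuhn simplices
is odd. -/
theorem sum_isRainbow {m : ℕ} (hm : 0 < m) (n : ℕ) (l : (Fin n → ℕ) → ℕ)
    (hle : ∀ v, l v ≤ n) (h0 : ∀ v (i : Fin n), v i = 0 → l v ≤ i) (h1 : ∀ v (i : Fin n), v i = m → l v ≠ i) :
    ∑ s ∈ kuhnSimplices m n,
      (if IsRainbow n (fun j => l (kuhnVertex s j)) then (1 : ZMod 2) else 0) = 1 := by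
  induction n with
  | zero =>
    have hr : ∀ s, IsRainbow 0 (fun j => l (kuhnVertex s j)) := fun s c hc =>
      ⟨0, le_rfl, (Nat.le_zero.1 (hle _)).trans (Nat.le_zero.1 hc).symm⟩
    have hu : kuhnSimplices m 0 = univ := by
      ext s
      simp [mem_kuhnSimplices, Function.injective_of_subsingleton]
    simp [hr, hu]
  | succ d ih =>
    have hrec := ih (fun v => l (Fin.snoc (α := fun _ => ℕ) v 0))
      (fun v => by simpa using h0 (Fin.snoc (α := fun _ => ℕ) v 0) (Fin.last d) (by simp))
      (fun v i hv => by
        simpa using h0 (Fin.snoc (α := fun _ => ℕ) v 0) i.castSucc (by simpa using hv))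
      (fun v i hv => by
        simpa using h1 (Fin.snoc (α := fun _ => ℕ) v 0) i.castSucc (by simpa using hv))
    simp_rw [← sum_isDoor (d + 1) _ (fun j => hle _)]
    rw [sum_comm, sum_range_succ, sum_range_succ',
      sum_eq_zero fun k hk => sum_isDoor_interior (by have := mem_range.1 hk; omega) l, zero_add,
      ← sum_filter_add_sum_filter_not (kuhnSimplices m (d + 1))
        (fun s => ∃ i, s.2 i = 0 ∧ s.1 i + 1 = m),
      ← sum_filter_add_sum_filter_not (kuhnSimplices m (d + 1))
        (fun s => ∃ i, s.2 i = d ∧ s.1 i = 0),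
      sum_isDoor_rotate, sum_isDoor_bottom hm l h0, hrec, sum_eq_zero, zero_add,
      add_left_comm, CharTwo.add_self_eq_zero, add_zero]
    intro s hs
    obtain ⟨hs, i, hi0, him⟩ := mem_filter.1 hs
    refine if_neg fun hd => ?_
    obtain ⟨j, hj, hj0, hjc⟩ := hd i i.2
    exact h1 (kuhnVertex s j) i (by simp only [kuhnVertex]; split_ifs <;> omega) hjc

theorem exists_isRainbow {m : ℕ} (hm : 0 < m) (n : ℕ) (l : (Fin n → ℕ) → ℕ)
    (hle : ∀ v, l v ≤ n) (h0 : ∀ v (i : Fin n), v i = 0 → l v ≤ i) (h1 : ∀ v (i : Fin n), v i = m → l v ≠ i) :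
    ∃ s ∈ kuhnSimplices m n, IsRainbow n (fun j => l (kuhnVertex s j)) := by
  classical
  by_contra! h
  have := sum_isRainbow hm n l hle h0 h1
  rw [sum_eq_zero fun s hs => if_neg (h s hs)] at this
  exact zero_ne_one this

theorem finite_cubical_sperner (m n : ℕ) (hm : 0 < m) (hn : 0 < n)
    (φ : (Fin n → Fin (m + 1)) → (Fin n → Bool))
    (hφ : ∀ σ σ' : Fin n → Fin (m + 1),
      (∃ i, (σ i : ℕ) = 0 ∧ (σ' i : ℕ) = m) → φ σ ≠ φ σ') :
    ∃ σ : Fin n → ℕ, (∀ i, σ i < m) ∧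
      n + 1 ≤ (φ '' {ρ | ∃ τ : Fin n → Bool,
        ∀ i, (ρ i : ℕ) = σ i + (if τ i then 1 else 0)}).ncard := by
  classical
  -- A colour is labelled by the first `i` for which it occurs on the facet `σ i = 0`.
  let P : (Fin n → Bool) → ℕ → Prop := fun c k =>
    k = n ∨ ∃ i : Fin n, (i : ℕ) = k ∧ ∃ σ, φ σ = c ∧ (σ i : ℕ) = 0
  have hP : ∀ c, ∃ k, P c k := fun c => ⟨n, Or.inl rfl⟩
  let L : (Fin n → Bool) → ℕ := fun c => Nat.find (hP c)
  let clamp : (Fin n → ℕ) → (Fin n → Fin (m + 1)) := fun v i => ⟨min (v i) m, by omega⟩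
  obtain ⟨s, hs, hr⟩ := exists_isRainbow hm n (fun v => L (φ (clamp v)))
    (fun v => Nat.find_min' _ (Or.inl rfl))
    (fun v i hv => Nat.find_min' _ (Or.inr ⟨i, rfl, clamp v, rfl, by simp [clamp, hv]⟩))
    (fun v i hv h => by
      have hspec : P (φ (clamp v)) (L (φ (clamp v))) := Nat.find_spec (hP _)
      rw [h] at hspec
      rcases hspec with hin | ⟨j, hji, σ, hσ, hσ0⟩
      · exact absurd hin i.2.ne
      · obtain rfl := Fin.ext hji
        exact hφ σ (clamp v) ⟨j, hσ0, by simp [clamp, hv]⟩ hσ)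
  obtain ⟨h1, -, -⟩ := mem_kuhnSimplices.1 hs
  refine ⟨s.1, h1, ?_⟩
  set S : Set (Fin n → Fin (m + 1)) := {ρ | ∃ τ : Fin n → Bool,
    ∀ i, (ρ i : ℕ) = s.1 i + (if τ i then 1 else 0)} with hS
  have hsub : (range (n + 1) : Set ℕ) ⊆ L '' (φ '' S) := by
    intro c hc
    obtain ⟨j, -, hjc⟩ := hr c (by simpa [Nat.lt_succ_iff] using hc)
    refine ⟨_, ⟨clamp (kuhnVertex s j), ⟨fun i => decide (s.2 i < j), fun i => ?_⟩, rfl⟩, hjc⟩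
    have := h1 i
    simp only [clamp, kuhnVertex, decide_eq_true_eq]
    split_ifs <;> omega
  calc n + 1 = (range (n + 1) : Set ℕ).ncard := by rw [Set.ncard_coe_finset, card_range]
    _ ≤ (L '' (φ '' S)).ncard := Set.ncard_le_ncard hsub (Set.toFinite _)
    _ ≤ (φ '' S).ncard := Set.ncard_image_le (Set.toFinite _)
end

section
/- For every uniformly continuous map f : U_∞ → U_∞ and every ε > 0 there exist a point x ∈ U_∞ and an infinite set A ⊆ ℕ such that |x(i) − (f(x))(i)| < ε for every i ∈ A. -/
open BoundedContinuousFunction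

/-- The constant sequence with value `t`, as a point of the cube. -/
noncomputable def constUinf (t : Set.Icc (0 : ℝ) 1) : ↥Uinf :=
  ⟨BoundedContinuousFunction.const ℕ (t : ℝ), fun _ => t.2⟩

lemma continuous_constUinf : Continuous constUinf := by
  refine (LipschitzWith.of_dist_le_mul (K := 1) fun s t => ?_).continuous
  rw [NNReal.coe_one, one_mul]
  exact (BoundedContinuousFunction.dist_le dist_nonneg).2 fun _ => le_rfl

lemma abs_coord_sub_le_dist (x y : ↥Uinf) (i : ℕ) :
    |(x : ℕ →ᵇ ℝ) i - (y : ℕ →ᵇ ℝ) i| ≤ dist x y :=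
  BoundedContinuousFunction.dist_coe_le_dist (f := (x : ℕ →ᵇ ℝ)) (g := (y : ℕ →ᵇ ℝ)) i

/-- On the diagonal of constant sequences, each coordinate of a continuous self-map of the cube
has a fixed point. -/
lemma exists_constUinf_coord_eq (f : ↥Uinf → ↥Uinf) (hf : Continuous f) (i : ℕ) :
    ∃ t : Set.Icc (0 : ℝ) 1, ((f (constUinf t) : ↥Uinf) : ℕ →ᵇ ℝ) i = t := by
  have hc : Continuous fun t : Set.Icc (0 : ℝ) 1 => (f (constUinf t) : ℕ →ᵇ ℝ) i :=
    (lipschitz_eval_const i).continuous.comp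
      (continuous_subtype_val.comp (hf.comp continuous_constUinf))
  obtain ⟨t, ht⟩ := intermediate_value_univ₂ (a := (1 : Set.Icc (0 : ℝ) 1)) (b := 0)
    hc continuous_subtype_val ((f _).2 i).2 ((f _).2 i).1
  exact ⟨t, ht⟩

theorem approximate_fixed_coordinates
    (f : ↥Uinf → ↥Uinf) (hf : UniformContinuous f) (ε : ℝ) (hε : 0 < ε) :
    ∃ x : ↥Uinf, ∃ A : Set ℕ, A.Infinite ∧
      ∀ i ∈ A, |(x : ℕ →ᵇ ℝ) i - ((f x : ℕ →ᵇ ℝ)) i| < ε := by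
  choose t ht using exists_constUinf_coord_eq f hf.continuous
  obtain ⟨s, φ, hφ, hs⟩ := CompactSpace.tendsto_subseq t
  have hfs := ((hf.continuous.comp continuous_constUinf).tendsto s).comp hs
  obtain ⟨N, hN⟩ := Filter.eventually_atTop.1
    ((Metric.tendsto_nhds.1 hs (ε / 2) (half_pos hε)).and
      (Metric.tendsto_nhds.1 hfs (ε / 2) (half_pos hε)))
  refine ⟨constUinf s, φ '' Set.Ici N, (Set.Ici_infinite N).image hφ.injective.injOn, ?_⟩
  rintro _ ⟨n, hn, rfl⟩
  obtain ⟨h₁, h₂⟩ := hN n hn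
  have h₃ := (abs_coord_sub_le_dist _ _ (φ n)).trans_lt h₂
  simp only [Function.comp_apply, ht] at h₃
  have h₄ : |(t (φ n) : ℝ) - s| < ε / 2 := h₁
  change |(s : ℝ) - _| < ε
  rw [abs_lt] at *
  constructor <;> linarith [h₃.1, h₃.2, h₄.1, h₄.2]
end

section
/- There exists a locally finite open cover 𝒱 of U_∞ with diam(V) < 1 for every V ∈ 𝒱; in particular, every point of U_∞ belongs to only finitely many members of 𝒱, so the infinitary Lebesgue covering theorem fails for arbitrary (non-uniform) open covers of U_∞. -/
open BoundedContinuousFunction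

theorem locally_finite_small_open_cover :
    ∃ 𝒱 : Set (Set ↥Uinf),
      ⋃₀ 𝒱 = Set.univ ∧
      (∀ V ∈ 𝒱, IsOpen V) ∧
      (∀ V ∈ 𝒱, Metric.diam V < 1) ∧
      LocallyFinite (fun V : 𝒱 => (V : Set ↥Uinf)) ∧
      ∀ x : ↥Uinf, {V ∈ 𝒱 | x ∈ V}.Finite := by
  obtain ⟨v, hv_open, hv_cover, hv_lf, hv_sub⟩ :=
    precise_refinement (fun x : ↥Uinf => Metric.ball x (1 / 3)) (fun _ => Metric.isOpen_ball)
      (Set.iUnion_eq_univ_iff.2 fun x => ⟨x, Metric.mem_ball_self (by norm_num)⟩)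
  refine ⟨Set.range v, by rwa [Set.sUnion_range], Set.forall_mem_range.2 hv_open,
    Set.forall_mem_range.2 fun x => ?_, hv_lf.on_range, fun x => ?_⟩
  · calc Metric.diam (v x) ≤ Metric.diam (Metric.ball x (1 / 3)) :=
          Metric.diam_mono (hv_sub x) Metric.isBounded_ball
      _ ≤ 2 * (1 / 3) := Metric.diam_ball (by norm_num)
      _ < 1 := by norm_num
  · refine ((hv_lf.point_finite x).image v).subset ?_
    rintro _ ⟨⟨y, rfl⟩, hy⟩
    exact ⟨y, hy, rfl⟩
end

section
/- The metric space U_∞ is not point-finite: there exists a uniform cover 𝒰 of U_∞ (for instance, the cover by all open balls of radius 1/4) such that every uniform cover 𝒱 of U_∞ refining 𝒰 fails to be point-finite, i.e. for every such 𝒱 there is a point x ∈ U_∞ belonging to infinitely many members of 𝒱. -/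
open BoundedContinuousFunction

namespace PointFinite

/-- The initial segment of length `m` of a sequence. -/
def initSeg {α : Type*} (m : ℕ) (f : ℕ → α) : List α := (List.range m).map f

theorem initSeg_eq_iff {α : Type*} {m : ℕ} {f g : ℕ → α} :
    initSeg m f = initSeg m g ↔ ∀ n < m, f n = g n := by
  simp [initSeg]

@[simp] theorem length_initSeg {α : Type*} (m : ℕ) (f : ℕ → α) : (initSeg m f).length = m := by
  simp [initSeg]

theorem initSeg_succ {α : Type*} (m : ℕ) (f : ℕ → α) :
    initSeg (m + 1) f = initSeg m f ++ [f m] := by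
  simp [initSeg, List.range_succ]

/-- The basic open sets of the dominating topology: sequences with stem `s` which lie above `C`
beyond the stem. -/
def cone (s : List ℕ) (C : ℕ → ℕ) : Set (ℕ → ℕ) :=
  {f | initSeg s.length f = s ∧ ∀ n, s.length ≤ n → C n ≤ f n}

/-- `Q` meets every cone with stem `s`. -/
def MeetsCones (s : List ℕ) (Q : Set (ℕ → ℕ)) : Prop := ∀ C, ∃ f ∈ cone s C, f ∈ Q

theorem exists_initSeg_meetsCones (Q : ℕ → Set (ℕ → ℕ)) (b : ℕ → ℕ) :
    ∃ f, b ≤ f ∧ ∀ n, f ∈ Q n → ∃ m, MeetsCones (initSeg m f) (Q n) := by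
  classical
  have key : ∀ (s : List ℕ) (R : Set (ℕ → ℕ)), ∃ D : ℕ → ℕ,
      ¬ MeetsCones s R → ∀ f ∈ cone s D, f ∉ R := by
    intro s R
    by_cases h : MeetsCones s R
    · exact ⟨0, fun h' => absurd h h'⟩
    · unfold MeetsCones at h
      push Not at h
      obtain ⟨D, hD⟩ := h
      exact ⟨D, fun _ => hD⟩
  choose D hD using key
  let st : ℕ → List ℕ × (ℕ → ℕ) := fun n => Nat.rec ([], b)
    (fun n p => (p.1 ++ [(p.2 ⊔ D p.1 (Q n)) n], p.2 ⊔ D p.1 (Q n))) n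
  have st1 : ∀ n, (st (n + 1)).1 = (st n).1 ++ [(st (n + 1)).2 n] := fun n => rfl
  have st2 : ∀ n, (st (n + 1)).2 = (st n).2 ⊔ D (st n).1 (Q n) := fun n => rfl
  have mono : Monotone fun n => (st n).2 :=
    monotone_nat_of_le_succ fun n => by
      change (st n).2 ≤ (st (n + 1)).2
      rw [st2]; exact le_sup_left
  let f : ℕ → ℕ := fun n => (st (n + 1)).2 n
  have hseg : ∀ n, initSeg n f = (st n).1 := by
    intro n
    induction n with
    | zero => rfl
    | succ n ih => rw [initSeg_succ, ih, st1]
  refine ⟨f, fun n => mono (Nat.zero_le (n + 1)) n, fun n hn => ⟨n, ?_⟩⟩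
  by_contra hbad
  refine hD _ _ hbad f ⟨by simp, fun j hj => ?_⟩ hn
  rw [length_initSeg] at hj
  have h1 : (st (n + 1)).2 j ≤ f j := mono (Nat.succ_le_succ hj) j
  refine le_trans ?_ h1
  rw [st2, hseg]
  exact le_sup_right (a := (st n).2 j)

/-- The indicator function of the region below the graph of `f`. -/
def below (f : ℕ → ℕ) : ℕ → ℕ → ℕ := fun m n => if n < f m then 1 else 0

theorem below_mono {f g : ℕ → ℕ} (h : f ≤ g) : below f ≤ below g := by
  intro m n
  have : f m ≤ g m := h m
  simp only [below]
  split_ifs <;> omega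

/-- `z` is equal to `j` below the graph of `b`, and each of its rows is finitely supported. -/
def Admissible (j : ℕ) (b : ℕ → ℕ) (z : ℕ → ℕ → ℕ) : Prop :=
  (∀ m n, n < b m → z m n = j) ∧ ∀ m, ∃ N, z m N = 0 ∧ ∀ n, N ≤ n → z m n = 0

theorem Admissible.add_below {j : ℕ} {b f : ℕ → ℕ} {z : ℕ → ℕ → ℕ} (h : Admissible j f z)
    (hbf : b ≤ f) : Admissible (j + 1) b (z + below f) := by
  constructor
  · intro m n hn
    have : b m ≤ f m := hbf m
    have h1 := h.1 m n (by omega)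
    simp only [Pi.add_apply, below, h1]
    rw [if_pos (by omega)]
  · intro m
    obtain ⟨N, -, hN⟩ := h.2 m
    have aux : ∀ n, max N (f m) ≤ n → (z + below f) m n = 0 := by
      intro n hn
      have := hN n (by omega)
      simp only [Pi.add_apply, below, this]
      rw [if_neg (by omega)]
    exact ⟨max N (f m), aux _ le_rfl, aux⟩

/-- Only finitely many colours occur on each unit cube. -/
def FiniteOnCubes {γ : Type*} (c : (ℕ → ℕ → ℕ) → γ) : Prop :=
  ∀ x₀, {y | ∃ x, x₀ ≤ x ∧ x ≤ 1 + x₀ ∧ c x = y}.Finite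

/-- Fast pointwise convergence of the codes `e` and the bounds `b`. -/
def FastConv {T : Type*} (e : T → ℕ → ℕ) (b : T → ℕ → ℕ) (t : ℕ → T) (t' : T) : Prop :=
  ∀ i, ∀ n < i, e (t i) n = e t' n ∧ b (t i) n = b t' n

/-- Along fast convergent sequences, the colours `G` are infinitely often realised simultaneously
by points of a common cube. -/
def Realises {γ T : Type*} (j : ℕ) (b : T → ℕ → ℕ) (c : T → (ℕ → ℕ → ℕ) → γ) (G : T → γ)
    (e : T → ℕ → ℕ) : Prop :=
  ∀ t t', FastConv e b t t' → ∃ φ : ℕ → ℕ, StrictMono φ ∧ ∃ z₀ : ℕ → ℕ → ℕ, ∃ z : ℕ → ℕ → ℕ → ℕ,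
    ∀ i, z₀ ≤ z i ∧ z i + below (b (t (φ i))) ≤ 1 + z₀ ∧ Admissible j (b (t (φ i))) (z i) ∧
      c (t (φ i)) (z i) = G (t (φ i))

theorem Realises.countable_range {γ : Type*} {j : ℕ} {c : (ℕ → ℕ → ℕ) → γ}
    (hc : FiniteOnCubes c) {G : (ℕ → ℕ) → γ} {e : (ℕ → ℕ) → ℕ → ℕ}
    (h : Realises j id (fun f z => c (z + below f)) G e) : (Set.range G).Countable := by
  classical
  by_contra hunc
  have hs : ∀ r : Set.range G, ∃ f, G f = r := fun r => r.2
  choose s hs using hs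
  let F : Set.range G → ℕ → ℕ × ℕ := fun r n => (s r n, e (s r) n)
  have hFinj : ∀ r r', (∀ n, F r n = F r' n) → r = r' := by
    intro r r' hrr
    have : s r = s r' := funext fun n => congrArg Prod.fst (hrr n)
    exact Subtype.ext (by rw [← hs r, ← hs r', this])
  have hacc : ∃ r', ∀ m, ∃ r, r ≠ r' ∧ initSeg m (F r) = initSeg m (F r') := by
    by_contra hno
    push Not at hno
    choose m hm using hno
    apply hunc
    have : Function.Injective fun r => initSeg (m r) (F r) := by
      intro r r' hrr
      by_contra hne
      have hlen : m r = m r' := by simpa using congrArg List.length hrr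
      refine hm r' r hne ?_
      rw [← hlen]
      simpa [hlen] using hrr
    exact Set.countable_coe_iff.mp this.countable
  obtain ⟨r', hr'⟩ := hacc
  choose r hne hr using hr'
  obtain ⟨φ, hφ, z₀, z, hz⟩ := h (fun i => s (r i)) (s r') (by
    intro i n hn
    have := initSeg_eq_iff.mp (hr i) n hn
    exact ⟨congrArg Prod.snd this, congrArg Prod.fst this⟩)
  have hfin := hc z₀
  have hmem : ∀ i, ((r (φ i) : Set.range G) : γ) ∈
      {y | ∃ x, z₀ ≤ x ∧ x ≤ 1 + z₀ ∧ c x = y} := by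
    intro i
    obtain ⟨h1, h2, -, h4⟩ := hz i
    exact ⟨z i + below (s (r (φ i))), h1.trans le_self_add, h2, h4.trans (hs _)⟩
  have := hfin.to_subtype
  obtain ⟨y, hy⟩ := Finite.exists_infinite_fiber fun i =>
    (⟨_, hmem i⟩ : {y | ∃ x, z₀ ≤ x ∧ x ≤ 1 + z₀ ∧ c x = y})
  have hy' := Set.infinite_coe_iff.mp hy
  obtain ⟨i₀, hi₀⟩ := hy'.nonempty
  apply hne (φ i₀)
  apply hFinj
  intro n
  obtain ⟨i, hi, hni⟩ := hy'.exists_gt n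
  have hii : r (φ i) = r (φ i₀) := by
    apply Subtype.ext
    have h1 := congrArg Subtype.val (show _ = y from hi)
    have h2 := congrArg Subtype.val (show _ = y from hi₀)
    exact h1.trans h2.symm
  rw [← hii]
  exact initSeg_eq_iff.mp (hr (φ i)) n (hni.trans_le hφ.le_apply)

/-- The sequences above `b` of colour `y` whose code has initial segment `u`. -/
def fiber {γ : Type*} (b : ℕ → ℕ) (G : (ℕ → ℕ) → γ) (F : (ℕ → ℕ) → ℕ → ℕ × ℕ) (y : γ)
    (u : List (ℕ × ℕ)) : Set (ℕ → ℕ) :=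
  {f | b ≤ f ∧ G f = y ∧ initSeg u.length (F f) = u}

/-- The sequences above `b` of colour `y` all of whose code approximations are realised in all
cones over some initial segment. -/
def typical {γ : Type*} (b : ℕ → ℕ) (G : (ℕ → ℕ) → γ) (F : (ℕ → ℕ) → ℕ → ℕ × ℕ) (y : γ) :
    Set (ℕ → ℕ) :=
  {f | b ≤ f ∧ G f = y ∧ ∀ m, ∃ n, MeetsCones (initSeg n f) (fiber b G F y (initSeg m (F f)))}

theorem exists_meetsCones_typical {γ : Type*} (b : ℕ → ℕ) (G : (ℕ → ℕ) → γ)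
    (F : (ℕ → ℕ) → ℕ → ℕ × ℕ) (hG : (Set.range G).Countable) :
    ∃ y s, MeetsCones s (typical b G F y) := by
  have := hG.to_subtype
  have : Nonempty (Set.range G) := ⟨⟨G 0, Set.mem_range_self _⟩⟩
  let Q : (Set.range G × List (ℕ × ℕ)) ⊕ Set.range G → Set (ℕ → ℕ) :=
    Sum.elim (fun p => fiber b G F p.1 p.2) (fun y => typical b G F y)
  obtain ⟨q, hq⟩ := exists_surjective_nat ((Set.range G × List (ℕ × ℕ)) ⊕ Set.range G)
  obtain ⟨f, hbf, hf⟩ := exists_initSeg_meetsCones (fun n => Q (q n)) b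
  have hf' : ∀ p, f ∈ Q p → ∃ m, MeetsCones (initSeg m f) (Q p) := by
    intro p hp
    obtain ⟨n, rfl⟩ := hq p
    exact hf n hp
  have htyp : f ∈ typical b G F (G f) := by
    refine ⟨hbf, rfl, fun m => ?_⟩
    exact hf' (Sum.inl (⟨G f, Set.mem_range_self _⟩, initSeg m (F f)))
      ⟨hbf, rfl, by rw [length_initSeg]⟩
  obtain ⟨m, hm⟩ := hf' (Sum.inr ⟨G f, Set.mem_range_self _⟩) htyp
  exact ⟨_, _, hm⟩

theorem exists_realises {γ : Type*} (j : ℕ) : ∀ {T : Type} (b : T → ℕ → ℕ)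
    (c : T → (ℕ → ℕ → ℕ) → γ), (∀ t, FiniteOnCubes (c t)) → ∃ G e, Realises j b c G e := by
  classical
  induction j with
  | zero =>
    intro T b c _
    refine ⟨fun t => c t 0, fun _ => 0, fun t t' _ => ⟨id, strictMono_id, 0, fun _ => 0, ?_⟩⟩
    intro i
    refine ⟨le_rfl, ?_, ⟨fun _ _ _ => rfl, fun _ => ⟨0, rfl, fun _ _ => rfl⟩⟩, rfl⟩
    intro m n
    simp only [Pi.add_apply, Pi.zero_apply, Pi.one_apply, below]
    split_ifs <;> simp
  | succ j ih =>
    intro T b c hc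
    have hc' : ∀ p : (ℕ → ℕ) × T, FiniteOnCubes fun z => c p.2 (z + below p.1) := by
      intro p x₀
      refine (hc p.2 (x₀ + below p.1)).subset ?_
      rintro y ⟨x, h1, h2, h3⟩
      refine ⟨x + below p.1, add_le_add_left h1 _, ?_, h3⟩
      rw [← add_assoc]
      exact add_le_add_left h2 _
    obtain ⟨G', e', hG'⟩ := ih (Prod.fst : (ℕ → ℕ) × T → ℕ → ℕ) _ hc'
    have hcount : ∀ t, (Set.range fun f => G' (f, t)).Countable := by
      intro t
      refine Realises.countable_range (j := j) (hc t) (e := fun f => e' (f, t)) ?_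
      intro s s' hs
      exact hG' (fun i => (s i, t)) (s', t) hs
    let F : T → (ℕ → ℕ) → ℕ → ℕ × ℕ := fun t f n => (f n, e' (f, t) n)
    choose G σ hσ using fun t =>
      exists_meetsCones_typical (b t) (fun f => G' (f, t)) (F t) (hcount t)
    let good : T → List (ℕ × ℕ) × List ℕ → Prop := fun t p =>
      MeetsCones p.2 (fiber (b t) (fun f => G' (f, t)) (F t) (G t) p.1)
    let e : T → ℕ → ℕ := fun t k =>
      if ∃ p : List (ℕ × ℕ) × List ℕ, Encodable.encode p = k ∧ good t p then 1 else 0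
    have he : ∀ t p, e t (Encodable.encode p) = 1 ↔ good t p := by
      intro t p
      simp only [e]
      constructor
      · intro h
        by_contra hp
        rw [if_neg] at h
        · exact zero_ne_one h
        · rintro ⟨q, hq, hq'⟩
          exact hp (Encodable.encode_injective hq ▸ hq')
      · intro hp
        exact if_pos ⟨p, rfl, hp⟩
    refine ⟨G, e, fun t t' ht => ?_⟩
    let L := (σ t').length
    let C : ℕ → ℕ := fun m => if m < L then b t' m else
      b t' m ⊔ (Finset.range (m + 1)).sup fun i => b (t i) m
    have hbC : ∀ i, L ≤ i → b (t i) ≤ C := by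
      intro i hi m
      by_cases hmi : m < i
      · rw [(ht i m hmi).2]
        simp only [C]
        split_ifs
        · exact le_rfl
        · exact le_sup_left
      · simp only [C]
        rw [if_neg (by omega)]
        exact le_sup_of_le_right (Finset.le_sup (f := fun i => b (t i) m)
          (Finset.mem_range.mpr (by omega)))
    obtain ⟨f', hf'cone, hbf', -, hf'typ⟩ := hσ t' C
    have hCf' : C ≤ f' := by
      intro m
      by_cases hm : m < L
      · simp only [C, if_pos hm]
        exact hbf' m
      · exact hf'cone.2 m (not_lt.mp hm)
    choose n hn using hf'typ
    obtain ⟨φ, hφ, hφ'⟩ := Filter.extraction_forall_of_eventually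
      (P := fun m i => L ≤ i ∧ good (t i) (initSeg m (F t' f'), initSeg (n m) f')) (by
        intro m
        filter_upwards [Filter.eventually_ge_atTop L, Filter.eventually_gt_atTop
          (Encodable.encode (initSeg m (F t' f'), initSeg (n m) f'))] with i hi hi'
        refine ⟨hi, ?_⟩
        rw [← he, (ht i _ hi').1, he]
        exact hn m)
    choose f hfcone hfib using fun m => (hφ' m).2 C
    have hCf : ∀ m, C ≤ f m := by
      intro m k
      by_cases hk : k < n m
      · have h1 := (hfcone m).1
        simp only [length_initSeg] at h1
        rw [initSeg_eq_iff.mp h1 k hk]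
        exact hCf' k
      · exact (hfcone m).2 k (by simpa using hk)
    obtain ⟨ψ, hψ, z₀, z, hz⟩ := hG' (fun m => (f m, t (φ m))) (f', t') (by
      intro m k hk
      have h1 := (hfib m).2.2
      simp only [length_initSeg] at h1
      have h2 := initSeg_eq_iff.mp h1 k hk
      exact ⟨congrArg Prod.snd h2, congrArg Prod.fst h2⟩)
    refine ⟨φ ∘ ψ, hφ.comp hψ, z₀ + below C, fun i => z i + below (f (ψ i)), fun i => ?_⟩
    obtain ⟨h1, h2, h3, h4⟩ := hz i
    refine ⟨add_le_add h1 (below_mono (hCf _)), ?_, h3.add_below (hfib (ψ i)).1,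
      h4.trans (hfib (ψ i)).2.1⟩
    rw [← add_assoc]
    exact add_le_add h2 (below_mono (hbC _ (hφ' _).1))

/-- A colouring with finitely many colours on each unit cube has a colour class containing two
points that differ by at least `j + 1` in some coordinate. -/
theorem exists_same_color {γ : Type*} (j : ℕ) (c : (ℕ → ℕ → ℕ) → γ) (hc : FiniteOnCubes c) :
    ∃ x x' m n, c x = c x' ∧ j + 1 ≤ x m n ∧ x' m n = 0 := by
  have hc' : ∀ f : ℕ → ℕ, FiniteOnCubes fun z => c (z + below f) := by
    intro f x₀
    refine (hc (x₀ + below f)).subset ?_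
    rintro y ⟨x, h1, h2, h3⟩
    refine ⟨x + below f, add_le_add_left h1 _, ?_, h3⟩
    rw [← add_assoc]
    exact add_le_add_left h2 _
  obtain ⟨G, e, hG⟩ := exists_realises j (id : (ℕ → ℕ) → ℕ → ℕ) _ hc'
  have hreal : ∀ f, ∃ x, Admissible (j + 1) f x ∧ c x = G f := by
    intro f
    obtain ⟨φ, -, z₀, z, hz⟩ := hG (fun _ => f) f fun _ _ _ => ⟨rfl, rfl⟩
    exact ⟨_, (hz 0).2.2.1.add_below le_rfl, (hz 0).2.2.2⟩
  choose x hx hxG using hreal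
  obtain ⟨q, hq⟩ := (Realises.countable_range hc hG).exists_eq_range (Set.range_nonempty G)
  have hq' : ∀ l, ∃ f, G f = q l := fun l => by
    have : q l ∈ Set.range G := hq ▸ Set.mem_range_self l
    exact this
  choose g hg using hq'
  choose N hN using fun l => (hx (g l)).2 l
  let f : ℕ → ℕ := fun l => N l + 1
  obtain ⟨l, hl⟩ : G f ∈ Set.range q := hq ▸ Set.mem_range_self f
  refine ⟨x f, x (g l), l, N l, ?_, ((hx f).1 l (N l) (Nat.lt_succ_self _)).ge, (hN l).1⟩
  rw [hxG, hxG, hg, hl]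

/-- The point of `Uinf` whose coordinates are those of `x`, truncated at `k` and scaled. -/
noncomputable def toUinf (k : ℕ) (x : ℕ → ℕ → ℕ) : Uinf :=
  ⟨BoundedContinuousFunction.ofNormedAddCommGroup
    (fun i => ((min (x i.unpair.1 i.unpair.2) k : ℕ) : ℝ) / k) continuous_of_discreteTopology 1
    (fun i => by
      rw [Real.norm_of_nonneg (by positivity)]
      exact div_le_one_of_le₀ (by exact_mod_cast min_le_right _ _) (by positivity)),
  fun i => ⟨by
      change (0 : ℝ) ≤ ((min (x i.unpair.1 i.unpair.2) k : ℕ) : ℝ) / k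
      positivity, by
      change ((min (x i.unpair.1 i.unpair.2) k : ℕ) : ℝ) / k ≤ 1
      exact div_le_one_of_le₀ (by exact_mod_cast min_le_right _ _) (by positivity)⟩⟩

theorem toUinf_apply (k : ℕ) (x : ℕ → ℕ → ℕ) (i : ℕ) :
    (toUinf k x : ℕ →ᵇ ℝ) i = ((min (x i.unpair.1 i.unpair.2) k : ℕ) : ℝ) / k := rfl

theorem dist_toUinf_le {k : ℕ} {x₀ x : ℕ → ℕ → ℕ} (h₀ : x₀ ≤ x) (h₁ : x ≤ 1 + x₀) :
    dist (toUinf k x₀) (toUinf k x) ≤ 1 / k := by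
  rw [Subtype.dist_eq, BoundedContinuousFunction.dist_le (by positivity)]
  intro i
  rw [toUinf_apply, toUinf_apply, Real.dist_eq, ← sub_div, abs_div, Nat.abs_cast]
  gcongr
  have h2 : x₀ i.unpair.1 i.unpair.2 ≤ x i.unpair.1 i.unpair.2 := h₀ _ _
  have h3 : x i.unpair.1 i.unpair.2 ≤ 1 + x₀ i.unpair.1 i.unpair.2 := h₁ _ _
  generalize x₀ i.unpair.1 i.unpair.2 = a at *
  generalize x i.unpair.1 i.unpair.2 = d at *
  have h4 : min a k ≤ min d k := by omega
  have h5 : min d k ≤ min a k + 1 := by omega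
  have h4' : ((min a k : ℕ) : ℝ) ≤ (min d k : ℕ) := by exact_mod_cast h4
  have h5' : ((min d k : ℕ) : ℝ) ≤ (min a k : ℕ) + 1 := by exact_mod_cast h5
  rw [abs_le]
  constructor <;> linarith

theorem one_le_dist_toUinf {k : ℕ} (hk : 0 < k) {x x' : ℕ → ℕ → ℕ} {m n : ℕ} (h : k ≤ x m n)
    (h' : x' m n = 0) : 1 ≤ dist (toUinf k x) (toUinf k x') := by
  rw [Subtype.dist_eq]
  refine le_trans ?_ (BoundedContinuousFunction.dist_coe_le_dist (Nat.pair m n))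
  have hk' : (k : ℝ) ≠ 0 := by positivity
  rw [toUinf_apply, toUinf_apply, Nat.unpair_pair]
  simp [h, h', hk']

theorem isBounded_Uinf (S : Set Uinf) : Bornology.IsBounded S := by
  refine Metric.isBounded_iff.mpr ⟨1, fun x _ y _ => ?_⟩
  rw [Subtype.dist_eq, BoundedContinuousFunction.dist_le zero_le_one]
  intro i
  have h1 := x.2 i
  have h2 := y.2 i
  rw [Real.dist_eq, abs_le]
  constructor <;> linarith [h1.1, h1.2, h2.1, h2.2]

end PointFinite

open PointFinite in
theorem Uinf_not_point_finite :
    ∃ 𝒰 : Set (Set ↥Uinf), IsUniformCover 𝒰 ∧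
      ∀ 𝒱 : Set (Set ↥Uinf), IsUniformCover 𝒱 → (∀ V ∈ 𝒱, ∃ U ∈ 𝒰, V ⊆ U) →
        ∃ x : ↥Uinf, {V ∈ 𝒱 | x ∈ V}.Infinite := by
  refine ⟨{U | Metric.diam U < 1}, ⟨?_, 1, one_pos, fun S hS => ⟨S, hS, subset_rfl⟩⟩, ?_⟩
  · exact Set.eq_univ_of_forall fun x => ⟨{x}, by simp, rfl⟩
  rintro 𝒱 ⟨-, ε, hε, hleb⟩ href
  by_contra hfin
  simp only [not_exists, Set.not_infinite] at hfin
  obtain ⟨j, hj⟩ := exists_nat_one_div_lt (half_pos hε)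
  have hV : ∀ x : ℕ → ℕ → ℕ, ∃ V ∈ 𝒱,
      Metric.closedBall (toUinf (j + 1) x) (1 / ((j + 1 : ℕ) : ℝ)) ⊆ V := by
    intro x
    refine hleb _ ((Metric.diam_closedBall (by positivity)).trans_lt ?_)
    push_cast
    linarith
  choose c hc𝒱 hc using hV
  have hcfin : FiniteOnCubes c := by
    intro x₀
    refine (hfin (toUinf (j + 1) x₀)).subset ?_
    rintro y ⟨x, h1, h2, rfl⟩
    exact ⟨hc𝒱 x, hc x (Metric.mem_closedBall.mpr (dist_toUinf_le h1 h2))⟩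
  obtain ⟨x, x', m, n, hcc, h1, h2⟩ := exists_same_color j c hcfin
  obtain ⟨U, hU, hVU⟩ := href _ (hc𝒱 x)
  have hself : ∀ x, toUinf (j + 1) x ∈ c x := fun x =>
    hc x (Metric.mem_closedBall_self (by positivity))
  have hdist := Metric.dist_le_diam_of_mem (isBounded_Uinf U) (hVU (hself x))
    (hVU (hcc ▸ hself x'))
  have := one_le_dist_toUinf (Nat.succ_pos j) h1 h2
  exact absurd (lt_of_le_of_lt (this.trans hdist) hU) (lt_irrefl _)
end

section
/- Assume the continuum hypothesis (2^{ℵ₀} = ℵ₁). Then for every positive integer m there exist an integer n ≥ m and a Sperner colouring φ : [n]^ω → {0,1}^ω such that the image φ(K_σ) is a countable set for every σ ∈ [n]^ω. -/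
open Cardinal

/-- A type of cardinality at most `ℵ₁` carries a well-order with countable initial segments. -/
theorem exists_linearOrder_countable_Iic {α : Type*} (h : #α ≤ aleph 1) :
    ∃ (_ : LinearOrder α) (_ : WellFoundedLT α), ∀ a : α, (Set.Iic a).Countable := by
  classical
  obtain ⟨r, _, hr⟩ := exists_ord_eq α
  let := linearOrderOfSTO r
  refine ⟨inferInstance, ⟨IsWellFounded.wf (r := r)⟩, fun a ↦ ?_⟩
  have hlt : #{b // r b a} < aleph 1 := (Cardinal.card_typein_lt a hr).trans_le h
  have hIio : (Set.Iio a).Countable := by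
    rw [← Cardinal.le_aleph0_iff_set_countable, ← Order.lt_succ_iff, succ_aleph0]
    exact hlt
  rw [← Set.Iio_insert]
  exact hIio.insert a

/-- Every point lies in the cube it indexes. -/
theorem mem_cube_self (n : ℕ) (σ : ℕ → Fin (n + 1)) : σ ∈ cube n σ :=
  ⟨fun _ ↦ false, fun i ↦ by have := (σ i).is_le; simp [this]⟩

/-- If every point is sent to the index of a cube containing it, then recording which coordinates
of that index are nonzero is a Sperner colouring. -/
theorem spernerColouring_of_mem_cube {n : ℕ} (hn : 2 ≤ n)
    (f : (ℕ → Fin (n + 1)) → ℕ → Fin (n + 1)) (hf : ∀ ρ, ρ ∈ cube n (f ρ)) :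
    SpernerColouring n fun ρ i ↦ decide ((f ρ i : ℕ) ≠ 0) := by
  have zero_of_zero (ρ i) (h : (ρ i : ℕ) = 0) : (f ρ i : ℕ) = 0 := by
    obtain ⟨τ, hτ⟩ := hf ρ
    have := hτ i
    omega
  have ne_zero_of_top (ρ i) (h : (ρ i : ℕ) = n) : (f ρ i : ℕ) ≠ 0 := by
    obtain ⟨τ, hτ⟩ := hf ρ
    have := hτ i
    split_ifs at this <;> omega
  rintro σ σ' ⟨i, ⟨h, h'⟩ | ⟨h, h'⟩⟩ heq
  · exact ne_zero_of_top σ' i h' (by simpa [zero_of_zero σ i h] using congrFun heq i)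
  · exact ne_zero_of_top σ i h (by simpa [zero_of_zero σ' i h'] using congrFun heq i)

theorem CH_sperner_colouring_with_countable_cubes
    (hCH : (2 : Cardinal) ^ aleph0 = aleph 1) (m : ℕ) (hm : 0 < m) :
    ∃ n : ℕ, m ≤ n ∧ ∃ φ : (ℕ → Fin (n + 1)) → (ℕ → Bool),
      SpernerColouring n φ ∧ ∀ σ : ℕ → Fin (n + 1), (φ '' cube n σ).Countable := by
  refine ⟨m + 1, m.le_succ, ?_⟩
  have hCH' : (2 : Cardinal.{0}) ^ aleph0 = aleph 1 := by
    apply Cardinal.lift_injective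
    simpa using hCH
  have hcard : #(ℕ → Fin (m + 1 + 1)) ≤ aleph 1 := by
    rw [← hCH', ← Cardinal.power_def, mk_nat, mk_fin]
    exact (nat_power_eq le_rfl (by omega)).le
  obtain ⟨_, hwf, hIic⟩ := exists_linearOrder_countable_Iic hcard
  have hne (ρ : ℕ → Fin (m + 1 + 1)) : {σ | ρ ∈ cube (m + 1) σ}.Nonempty :=
    ⟨ρ, mem_cube_self _ ρ⟩
  refine ⟨_, spernerColouring_of_mem_cube (by omega) (fun ρ ↦ hwf.wf.min _ (hne ρ))
    fun ρ ↦ hwf.wf.min_mem _ (hne ρ), fun σ ↦ ?_⟩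
  refine ((hIic σ).image fun σ' i ↦ decide ((σ' i : ℕ) ≠ 0)).mono ?_
  rintro _ ⟨ρ, hρ, rfl⟩
  exact ⟨_, not_lt.1 (hwf.wf.not_lt_min {σ | ρ ∈ cube (m + 1) σ} hρ), rfl⟩
end

section
/- Let n be a positive integer and let φ be a Sperner colouring of [n]^{<ω} with values in an arbitrary set. Then there exist a sequence σ_1, σ_2, … of elements of [n]^{<ω} and a sequence τ_1, τ_2, … of pairwise distinct colours such that for every k: (1) {τ_1,…,τ_k} ⊆ φ(K_{σ_k}^{<ω}), and (2) σ_{k+1}(i) = σ_k(i) for every i in the support of σ_k. -/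
/-- The cube `K_σ^{<ω}` with index `σ ∈ [n]^{<ω}`: all points `σ ⊕ τ` with finitely
supported `τ : ℕ → {0,1}`, where `(σ ⊕ τ)(i) = min (n, σ(i) + τ(i))`. -/
def cubeLt (n : ℕ) (σ : ℕ → Fin (n + 1)) : Set (ℕ → Fin (n + 1)) :=
  {ρ | ∃ τ : ℕ → Bool, {i | τ i}.Finite ∧
    ∀ i, (ρ i : ℕ) = min n ((σ i : ℕ) + (if τ i then 1 else 0))}

/-- `φ` is a Sperner colouring of `[n]^{<ω}` (the finitely supported elements of
`[n]^ω`): `φ σ ≠ φ σ'` whenever some coordinate takes the values `0` and `n`. -/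
def SpernerColouringLt {C : Type*} (n : ℕ) (φ : (ℕ → Fin (n + 1)) → C) : Prop :=
  ∀ σ σ' : ℕ → Fin (n + 1), {i | σ i ≠ 0}.Finite → {i | σ' i ≠ 0}.Finite →
    (∃ i, ((σ i : ℕ) = 0 ∧ (σ' i : ℕ) = n) ∨ ((σ i : ℕ) = n ∧ (σ' i : ℕ) = 0)) →
    φ σ ≠ φ σ'

namespace SpernerList

open Filter

/-- The word obtained from the variable word `u` (with variable `none`) by substituting `a`. -/
def inst {α : Type*} (u : List (Option α)) (a : α) : List α := u.map (·.getD a)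

theorem inst_append {α : Type*} (u v : List (Option α)) (a : α) :
    inst (u ++ v) a = inst u a ++ inst v a := List.map_append

theorem inst_map_some {α : Type*} (f : List α) (a : α) : inst (f.map some) a = f := by
  simp [inst]

section Ultrafilters

attribute [local instance] Ultrafilter.mul Ultrafilter.semigroup

/-- Every member of `U` contains a combinatorial line. -/
def ContainsLines {α : Type*} (U : Ultrafilter (FreeMonoid α)) : Prop :=
  ∀ A ∈ U, ∃ u : List (Option α), none ∈ u ∧ ∀ a, FreeMonoid.ofList (inst u a) ∈ A

theorem exists_line_of_sUnion_eq_univ {α : Type*} [Finite α] (T : Set (Set (FreeMonoid α)))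
    (hT : T.Finite) (hU : ⋃₀ T = Set.univ) :
    ∃ A ∈ T, ∃ u : List (Option α), none ∈ u ∧ ∀ a, FreeMonoid.ofList (inst u a) ∈ A := by
  have : Finite T := hT
  obtain ⟨ι, _, hι⟩ := Combinatorics.Line.exists_mono_in_high_dimension α T
  have hc : ∀ x : FreeMonoid α, ∃ A : T, x ∈ A.1 := fun x => by
    obtain ⟨A, hA, hx⟩ := Set.mem_sUnion.1 (hU ▸ Set.mem_univ x)
    exact ⟨⟨A, hA⟩, hx⟩
  choose c hc using hc
  obtain ⟨l, A, hl⟩ := hι fun x => c (FreeMonoid.ofList (Finset.univ.toList.map x))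
  refine ⟨A, A.2, Finset.univ.toList.map l.idxFun, ?_, fun a => ?_⟩
  · obtain ⟨i, hi⟩ := l.proper
    exact List.mem_map.2 ⟨i, by simp, hi⟩
  · rw [← hl a]
    convert hc _ using 1
    simp [inst, Function.comp_def]

theorem exists_containsLines (α : Type*) [Finite α] :
    ∃ U : Ultrafilter (FreeMonoid α), ContainsLines U := by
  obtain ⟨U, hU⟩ := Ultrafilter.exists_ultrafilter_of_finite_inter_nonempty
    {A : Set (FreeMonoid α) | ¬ ∃ u : List (Option α), none ∈ u ∧
      ∀ a, FreeMonoid.ofList (inst u a) ∈ Aᶜ} (by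
    intro T hT
    by_contra hne
    obtain ⟨A, ⟨B, hB, rfl⟩, h⟩ := exists_line_of_sUnion_eq_univ
      (compl '' (T : Set (Set (FreeMonoid α)))) (T.finite_toSet.image _) (by
        rw [← Set.compl_sInter, Set.not_nonempty_iff_eq_empty.1 hne, Set.compl_empty])
    exact hT hB h)
  refine ⟨U, fun A hA => ?_⟩
  by_contra h
  have : Aᶜ ∈ U := hU (by simpa using h)
  exact Ultrafilter.compl_notMem_iff.2 hA this

theorem ContainsLines.mul {α : Type*} [Finite α] {U V : Ultrafilter (FreeMonoid α)}
    (hU : ContainsLines U) : ContainsLines (U * V) := by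
  intro A hA
  have hA' : {x | {y | x * y ∈ A} ∈ V} ∈ U := (Ultrafilter.eventually_mul U V (· ∈ A)).1 hA
  obtain ⟨u, hu, hl⟩ := hU _ hA'
  have : ∀ᶠ y in (V : Filter (FreeMonoid α)), ∀ a, FreeMonoid.ofList (inst u a) * y ∈ A :=
    eventually_all.2 hl
  obtain ⟨y, hy⟩ := this.exists
  refine ⟨u ++ (FreeMonoid.toList y).map some, by simp [hu], fun a => ?_⟩
  rw [inst_append, inst_map_some]
  exact hy a

theorem exists_idempotent_containsLines (α : Type*) [Finite α] :
    ∃ U : Ultrafilter (FreeMonoid α), ContainsLines U ∧ U * U = U := by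
  refine exists_idempotent_in_compact_subsemigroup Ultrafilter.continuous_mul_left
    {U | ContainsLines U} (exists_containsLines α) (IsClosed.isCompact ?_)
    fun U hU V _ => hU.mul
  have : {U : Ultrafilter (FreeMonoid α) | ContainsLines U} =
      ⋂ A ∈ {A : Set (FreeMonoid α) | ¬ ∃ u : List (Option α), none ∈ u ∧
        ∀ a, FreeMonoid.ofList (inst u a) ∈ A}, {U | A ∈ U}ᶜ := by
    ext U
    simp only [ContainsLines, Set.mem_iInter, Set.mem_ofPred_eq, Set.mem_compl_iff]
    exact forall_congr' fun A => not_imp_not.symm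
  rw [this]
  exact isClosed_biInter fun A _ => (ultrafilter_isOpen_basic A).isClosed_compl

/-- An idempotent ultrafilter of words all of whose members contain combinatorial lines. -/
theorem exists_line_ultrafilter (α : Type*) [Finite α] :
    ∃ U : Ultrafilter (List α),
      (∀ A ∈ U, ∃ u : List (Option α), none ∈ u ∧ ∀ a, inst u a ∈ A) ∧
      ∀ p : List α → Prop, (∀ᶠ x in U, p x) → ∀ᶠ x in U, ∀ᶠ y in U, p (x ++ y) := by
  obtain ⟨U, hU, hUU⟩ := exists_idempotent_containsLines α
  refine ⟨U, hU, fun p hp => ?_⟩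
  rw [← hUU] at hp
  exact hp

end Ultrafilters

section Substitution

variable {α : Type*}

/-- Substitute the letters of a word successively into the variable words `w 0, w 1, …`. -/
def sub : (ℕ → List (Option α)) → List α → List α
  | _, [] => []
  | w, a :: l => inst (w 0) a ++ sub (fun i => w (i + 1)) l

theorem sub_append (w : ℕ → List (Option α)) (l l' : List α) :
    sub w (l ++ l') = sub w l ++ sub (fun i => w (i + l.length)) l' := by
  induction l generalizing w with
  | nil => simp [sub]
  | cons a l ih => simp [sub, ih, Nat.add_assoc]

theorem sub_concat (w : ℕ → List (Option α)) (l : List α) (a : α) :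
    sub w (l ++ [a]) = sub w l ++ inst (w l.length) a := by
  simp [sub_append, sub]

theorem length_sub (w : ℕ → List (Option α)) {l l' : List α} (h : l.length = l'.length) :
    (sub w l).length = (sub w l').length := by
  induction l generalizing w l' with
  | nil => simp_all [sub, eq_comm]
  | cons a l ih =>
    obtain _ | ⟨b, l'⟩ := l'
    · simp at h
    · simp [sub, inst, ih _ (Nat.succ_injective h)]

theorem forall_mem_inst {P : α → Prop} {u : List (Option α)} (hu : ∀ c, some c ∈ u → P c)
    {a : α} (ha : P a) : ∀ x ∈ inst u a, P x := by
  simp only [inst, List.mem_map]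
  rintro x ⟨o, ho, rfl⟩
  cases o with
  | none => exact ha
  | some c => exact hu c ho

theorem forall_mem_sub {P : α → Prop} {w : ℕ → List (Option α)}
    (hw : ∀ j c, some c ∈ w j → P c) {l : List α} (hl : ∀ x ∈ l, P x) : ∀ x ∈ sub w l, P x := by
  induction l generalizing w with
  | nil => simp [sub]
  | cons a l ih =>
    intro x hx
    rcases List.mem_append.1 hx with h | h
    · exact forall_mem_inst (hw 0) (hl a (by simp)) x h
    · exact ih (fun j => hw (j + 1)) (fun x hx => hl x (by simp [hx])) x h

theorem forall₂_sub {R : α → α → Prop} (hR : ∀ a, R a a) (w : ℕ → List (Option α))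
    {l l' : List α} (h : List.Forall₂ R l l') : List.Forall₂ R (sub w l) (sub w l') := by
  induction h generalizing w with
  | nil => exact .nil
  | @cons a b l l' hab _ ih =>
    refine List.rel_append ?_ (ih _)
    refine List.forall₂_map_left_iff.2 (List.forall₂_map_right_iff.2 (List.forall₂_same.2 ?_))
    rintro (_ | c) _
    exacts [hab, hR c]

/-- Words can be chosen one after the other, each suiting the finitely many substitutions into its
predecessors. -/
theorem exists_fusion [Finite α] {R : List (Option α) → Prop}
    {Q : List α → List (Option α) → Prop}
    (h : ∀ L : Set (List α), L.Finite → ∃ u, R u ∧ ∀ l ∈ L, Q l u) :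
    ∃ w : ℕ → List (Option α), (∀ j, R (w j)) ∧ ∀ l, Q (sub w l) (w l.length) := by
  choose W hR hQ using h
  let S : ℕ → {L : Set (List α) // L.Finite} := fun j => Nat.rec ⟨{[]}, Set.finite_singleton _⟩
    (fun _ L => ⟨Set.image2 (fun l a => l ++ inst (W L.1 L.2) a) L.1 Set.univ,
      L.2.image2 _ Set.finite_univ⟩) j
  let w : ℕ → List (Option α) := fun j => W (S j).1 (S j).2
  have hS : ∀ l, sub w l ∈ (S l.length).1 := by
    intro l
    induction l using List.reverseRecOn with
    | nil => exact Set.mem_singleton _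
    | append_singleton l a ih =>
      rw [sub_concat, List.length_append]
      exact ⟨_, ih, a, Set.mem_univ _, rfl⟩
  exact ⟨w, fun j => hR _ _, fun l => hQ _ _ _ (hS l)⟩

end Substitution

section Words

variable {n : ℕ} {C : Type*}

/-- The letter `b` is `a` or `a + 1`. -/
def Step (a b : Fin (n + 1)) : Prop := a ≤ b ∧ (b : ℕ) ≤ a + 1

theorem Step.refl (a : Fin (n + 1)) : Step a a := ⟨le_rfl, Nat.le_succ _⟩

theorem Step.eq_min {a b : Fin (n + 1)} (h : Step a b) :
    (b : ℕ) = min n ((a : ℕ) + if decide (a ≠ b) then 1 else 0) := by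
  by_cases hab : a = b
  · subst hab
    simpa using a.is_le
  · have h₁ : (a : ℕ) ≤ b := h.1
    have h₂ := h.2
    have h₃ : (a : ℕ) ≠ b := fun e => hab (Fin.ext e)
    have h₄ := b.is_le
    simp only [ne_eq, hab, not_false_eq_true, decide_true, if_true]
    omega

/-- All letters of the word `l` are at most `m`. -/
def Bdd (m : ℕ) (l : List (Fin (n + 1))) : Prop := ∀ x ∈ l, (x : ℕ) ≤ m

theorem Bdd.append {m : ℕ} {l l' : List (Fin (n + 1))} (h : Bdd m l) (h' : Bdd m l') :
    Bdd m (l ++ l') := fun x hx => (List.mem_append.1 hx).elim (h x) (h' x)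

theorem Bdd.mono {m m' : ℕ} (hm : m ≤ m') {l : List (Fin (n + 1))} (h : Bdd m l) : Bdd m' l :=
  fun x hx => (h x hx).trans hm

theorem bdd_zero (m : ℕ) : Bdd m [(0 : Fin (n + 1))] := by simp [Bdd]

theorem Bdd.exists_step {m : ℕ} {y : List (Fin (n + 1))} (hy : Bdd (m + 1) y) :
    ∃ z, Bdd m z ∧ List.Forall₂ Step z y := by
  induction y with
  | nil => exact ⟨[], by simp [Bdd], .nil⟩
  | cons a y ih =>
    obtain ⟨z, hz, hzy⟩ := ih fun x hx => hy x (by simp [hx])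
    have ha : (a : ℕ) ≤ m + 1 := hy a (by simp)
    refine ⟨⟨a - 1, by omega⟩ :: z, fun x hx => ?_, .cons ⟨?_, ?_⟩ hzy⟩
    · rcases List.mem_cons.1 hx with rfl | h
      · simpa using ha
      · exact hz x h
    · simp [Fin.le_def]
    · simp only; omega

/-- The Sperner condition for colourings of words. -/
def Sperner (φ : List (Fin (n + 1)) → C) : Prop :=
  ∀ p p' s s' : List (Fin (n + 1)), p.length = p'.length →
    φ (p ++ 0 :: s) ≠ φ (p' ++ Fin.last n :: s')

/-- The chain of cubes and colours sought, for colourings of words. -/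
def HasChain (φ : List (Fin (n + 1)) → C) : Prop :=
  ∃ l : ℕ → List (Fin (n + 1)), ∃ τ : ℕ → C, Function.Injective τ ∧
    (∀ k, ∀ j ≤ k, ∃ ρ, List.Forall₂ Step (l k) ρ ∧ φ ρ = τ j) ∧ ∀ k, l k <+: l (k + 1)

/-- Nonempty extensions of a word `l` by letters at most `m` all have colour `χ l`. -/
structure Stable (m : ℕ) (φ χ : List (Fin (n + 1)) → C) : Prop where
  concat_left : ∀ l (a : Fin (n + 1)), (a : ℕ) ≤ m → φ (l ++ [a]) = χ l
  concat_right : ∀ l (a : Fin (n + 1)), (a : ℕ) ≤ m → χ (l ++ [a]) = χ l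

theorem Stable.append {m : ℕ} {φ χ : List (Fin (n + 1)) → C} (h : Stable m φ χ)
    (l : List (Fin (n + 1))) {y : List (Fin (n + 1))} (hy : Bdd m y) : χ (l ++ y) = χ l := by
  induction y generalizing l with
  | nil => simp
  | cons a y ih =>
    rw [List.append_cons, ih _ fun x hx => hy x (by simp [hx]),
      h.concat_right _ _ (hy a (by simp))]

theorem Sperner.comp_sub {φ : List (Fin (n + 1)) → C} (h : Sperner φ)
    {w : ℕ → List (Option (Fin (n + 1)))} (hw : ∀ j, none ∈ w j) :
    Sperner fun l => φ (sub w l) := by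
  intro p p' s s' hp
  obtain ⟨u, v, huv⟩ := List.append_of_mem (hw p.length)
  have key : ∀ q r : List (Fin (n + 1)), ∀ a, p.length = q.length → ∃ r',
      sub w (q ++ a :: r) = (sub w q ++ inst u a) ++ a :: r' := by
    intro q r a hq
    refine ⟨inst v a ++ sub (fun i => w (i + (q ++ [a]).length)) r, ?_⟩
    rw [List.append_cons, sub_append, sub_concat, ← hq, huv]
    simp only [inst, List.map_append, List.map_cons, List.append_assoc, List.cons_append]
    rfl
  obtain ⟨r, hr⟩ := key p s 0 rfl
  obtain ⟨r', hr'⟩ := key p' s' (Fin.last n) hp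
  dsimp only
  rw [hr, hr']
  exact h _ _ _ _ (by simp [inst, length_sub w hp])

theorem HasChain.of_comp_sub {φ : List (Fin (n + 1)) → C}
    {w : ℕ → List (Option (Fin (n + 1)))} (h : HasChain fun l => φ (sub w l)) : HasChain φ := by
  obtain ⟨l, τ, hτ, hc, hl⟩ := h
  refine ⟨fun k => sub w (l k), τ, hτ, fun k j hj => ?_, fun k => ?_⟩
  · obtain ⟨ρ, hρ, e⟩ := hc k j hj
    exact ⟨_, forall₂_sub Step.refl w hρ, e⟩
  · obtain ⟨t, ht⟩ := hl k
    exact ⟨_, by rw [← sub_append, ht]⟩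

theorem hasChain_of_extend {φ : List (Fin (n + 1)) → C} (P : List (Fin (n + 1)) → Set C → Prop)
    {l₀ : List (Fin (n + 1))} (h₀ : P l₀ ∅)
    (hP : ∀ l T, P l T → ∀ c ∈ T, ∃ ρ, List.Forall₂ Step l ρ ∧ φ ρ = c)
    (hext : ∀ l T, P l T → ∃ l' c, l <+: l' ∧ c ∉ T ∧ P l' (insert c T)) : HasChain φ := by
  choose E c hE hc hPE using hext
  let S : ℕ → {x : List (Fin (n + 1)) × Set C // P x.1 x.2} := fun k =>
    Nat.rec ⟨(l₀, ∅), h₀⟩ (fun _ x => ⟨(E _ _ x.2, insert (c _ _ x.2) x.1.2), hPE _ _ x.2⟩) k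
  have hmono : Monotone fun k => (S k).1.2 :=
    monotone_nat_of_le_succ fun k => Set.subset_insert _ _
  have hmem : ∀ {j k}, j < k → c _ _ (S j).2 ∈ (S k).1.2 := fun h =>
    hmono (Nat.succ_le_of_lt h) (Set.mem_insert _ _)
  have hne : ∀ {j k}, j < k → c _ _ (S j).2 ≠ c _ _ (S k).2 := fun {j k} h e =>
    hc _ _ (S k).2 (e ▸ hmem h)
  refine ⟨fun k => (S (k + 1)).1.1, fun k => c _ _ (S k).2, fun j k e => ?_,
    fun k j hj => hP _ _ (S (k + 1)).2 _ (hmem (Nat.lt_succ_of_le hj)),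
    fun k => hE _ _ (S (k + 1)).2⟩
  rcases lt_trichotomy j k with h | h | h
  exacts [(hne h e).elim, h, (hne h e.symm).elim]

/-- In a stable colouring without chain, every word has an extension all of whose further
extensions by letters at most `m + 1` have finitely many colours. -/
theorem Stable.exists_filler {m : ℕ} {φ χ : List (Fin (n + 1)) → C} (h : Stable m φ χ)
    (hφ : ¬ HasChain φ) (l₀ : List (Fin (n + 1))) :
    ∃ f, Bdd m f ∧ {c | ∃ y, Bdd (m + 1) y ∧ χ (l₀ ++ f ++ y) = c}.Finite := by
  by_contra! hinf
  refine hφ (hasChain_of_extend (l₀ := l₀) (fun l T => (∃ f, Bdd m f ∧ l = l₀ ++ f) ∧ T.Finite ∧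
    ∀ c ∈ T, ∃ ρ, List.Forall₂ Step l ρ ∧ φ ρ = c ∧ χ ρ = c)
    ⟨⟨[], by simp [Bdd], by simp⟩, Set.finite_empty, by simp⟩ ?_ ?_)
  · rintro l T ⟨-, -, hT⟩ c hc
    obtain ⟨ρ, h₁, h₂, -⟩ := hT c hc
    exact ⟨ρ, h₁, h₂⟩
  · rintro l T ⟨⟨f, hf, rfl⟩, hTf, hT⟩
    obtain ⟨c, ⟨y, hy, hyc⟩, hcT⟩ := (hinf f hf).exists_notMem_finite hTf
    obtain ⟨z, hz, hzy⟩ := hy.exists_step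
    have hz0 : List.Forall₂ Step (z ++ [(0 : Fin (n + 1))]) (y ++ [0]) :=
      List.rel_append hzy (.cons (Step.refl _) .nil)
    refine ⟨l₀ ++ f ++ (z ++ [0]), c, List.prefix_append _ _, hcT,
      ⟨f ++ (z ++ [0]), hf.append (hz.append (bdd_zero m)), by simp⟩, hTf.insert c, ?_⟩
    rintro d (rfl | hd)
    · refine ⟨l₀ ++ f ++ (y ++ [0]), List.rel_append
        (List.forall₂_same.2 fun x _ => Step.refl x) hz0, ?_⟩
      rw [← List.append_assoc, h.concat_left _ _ (by simp), h.concat_right _ _ (by simp)]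
      exact ⟨hyc, hyc⟩
    · obtain ⟨ρ, h₁, -, h₃⟩ := hT d hd
      refine ⟨ρ ++ (z ++ [0]), List.rel_append h₁
        (List.forall₂_same.2 fun x _ => Step.refl x), ?_⟩
      rw [h.append ρ (hz.append (bdd_zero m)), ← List.append_assoc,
        h.concat_left _ _ (by simp), h.append ρ hz]
      exact ⟨h₃, h₃⟩

theorem Stable.exists_common_filler {m : ℕ} {φ χ : List (Fin (n + 1)) → C} (h : Stable m φ χ)
    (hφ : ¬ HasChain φ) {L : Set (List (Fin (n + 1)))} (hL : L.Finite) :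
    ∃ f, Bdd m f ∧ ∀ l ∈ L, {c | ∃ y, Bdd (m + 1) y ∧ χ (l ++ f ++ y) = c}.Finite := by
  induction L, hL using Set.Finite.induction_on with
  | empty => exact ⟨[], by simp [Bdd], by simp⟩
  | @insert l L _ _ ih =>
    obtain ⟨f, hf, hfL⟩ := ih
    obtain ⟨g, hg, hgl⟩ := h.exists_filler hφ (l ++ f)
    refine ⟨f ++ g, hf.append hg, ?_⟩
    rintro l' (rfl | hl')
    · simpa using hgl
    · refine (hfL l' hl').subset ?_
      rintro _ ⟨y, hy, rfl⟩
      exact ⟨g ++ y, (hg.mono m.le_succ).append hy, by simp⟩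

/-- Each word has finitely many colours on its extensions by letters at most `m`. -/
def FiniteRange (m : ℕ) (φ : List (Fin (n + 1)) → C) : Prop :=
  ∀ l, {c | ∃ y, Bdd m y ∧ φ (l ++ y) = c}.Finite

theorem Stable.exists_finiteRange {m : ℕ} {φ χ : List (Fin (n + 1)) → C} (h : Stable m φ χ)
    (hφ : ¬ HasChain φ) : ∃ w : ℕ → List (Option (Fin (n + 1))), (∀ j, none ∈ w j) ∧
      FiniteRange (m + 1) fun l => φ (sub w l) := by
  obtain ⟨w, hw, hQ⟩ := exists_fusion
    (R := fun u => ∃ f : List (Fin (n + 1)), Bdd m f ∧ u = f.map some ++ [none, some 0])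
    (Q := fun l u => {c | ∃ y, Bdd (m + 1) y ∧ ∃ f : List (Fin (n + 1)),
      u = f.map some ++ [none, some 0] ∧ χ (l ++ f ++ y) = c}.Finite) (by
    intro L hL
    obtain ⟨f, hf, hfL⟩ := h.exists_common_filler hφ hL
    refine ⟨_, ⟨f, hf, rfl⟩, fun l hl => (hfL l hl).subset ?_⟩
    rintro c ⟨y, hy, g, hg, hc⟩
    have : f = g := List.map_injective_iff.2 (Option.some_injective _) (by simpa using hg)
    exact ⟨y, hy, this ▸ hc⟩)
  have hb : ∀ j c, some c ∈ w j → (c : ℕ) ≤ m + 1 := by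
    intro j c hc
    obtain ⟨f, hf, e⟩ := hw j
    simp only [e, List.mem_append, List.mem_map, Option.some.injEq, exists_eq_right,
      List.mem_cons, reduceCtorEq, List.not_mem_nil, or_false, false_or] at hc
    rcases hc with hc | rfl
    · exact (hf c hc).trans m.le_succ
    · simp
  have hn : ∀ j, none ∈ w j := fun j => by
    obtain ⟨f, -, e⟩ := hw j
    simp [e]
  refine ⟨w, hn, fun l => ((hQ l).union (Set.finite_singleton (φ (sub w l)))).subset ?_⟩
  rintro _ ⟨y, hy, rfl⟩
  obtain _ | ⟨a, y⟩ := y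
  · right; simp
  · left
    obtain ⟨f, hf, e⟩ := hw l.length
    have ha : (a : ℕ) ≤ m + 1 := hy a (by simp)
    rcases List.eq_nil_or_concat y with rfl | ⟨y, b, rfl⟩
    · refine ⟨[a], by simpa [Bdd] using ha, f, e, ?_⟩
      dsimp only
      rw [sub_concat, e, inst_append, inst_map_some]
      simpa [inst] using (h.concat_left (sub w l ++ f ++ [a]) 0 (by simp)).symm
    · obtain ⟨g, hg, e'⟩ := hw (l ++ a :: y).length
      refine ⟨[a, 0] ++ sub (fun i => w (i + (l.length + 1))) y ++ g ++ [b], ?_, f, e, ?_⟩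
      · refine ((Bdd.append ?_ ?_).append (hg.mono m.le_succ)).append ?_
        · simpa [Bdd] using ha
        · exact forall_mem_sub (fun j => hb _) fun x hx => hy x (by simp [hx])
        · simpa [Bdd] using hy b (by simp)
      · have : sub w (l ++ a :: (y ++ [b])) = sub w l ++ f ++
            ([a, 0] ++ sub (fun i => w (i + (l.length + 1))) y ++ g ++ [b]) ++ [0] := by
          rw [← List.cons_append, ← List.append_assoc, sub_concat, e', List.append_cons,
            sub_append, sub_concat, e, inst_append, inst_append, inst_map_some, inst_map_some]
          simp [inst]
        dsimp only
        rw [List.concat_eq_append, this, h.concat_left _ _ (by simp)]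

theorem FiniteRange.exists_stable {m : ℕ} {φ : List (Fin (n + 1)) → C} (h : FiniteRange m φ) :
    ∃ w : ℕ → List (Option (Fin (n + 1))), (∀ j, none ∈ w j) ∧
      ∃ χ, Stable m (fun l => φ (sub w l)) χ := by
  obtain ⟨U, hU, hUU⟩ := exists_line_ultrafilter {a : Fin (n + 1) // (a : ℕ) ≤ m}
  let vals : List {a : Fin (n + 1) // (a : ℕ) ≤ m} → List (Fin (n + 1)) := List.map Subtype.val
  have hlim : ∀ l, ∃ c, ∀ᶠ x in U, φ (l ++ vals x) = c := by
    intro l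
    obtain ⟨c, -, hc⟩ := (Ultrafilter.eventually_exists_mem_iff (f := U)
      (P := fun c x => φ (l ++ vals x) = c) (h l)).1 (.of_forall fun x => ⟨_, ⟨_, fun y hy => by
          obtain ⟨z, -, rfl⟩ := List.mem_map.1 hy
          exact z.2, rfl⟩, rfl⟩)
    exact ⟨c, hc⟩
  choose χ hχ using hlim
  have hidem : ∀ l, ∀ᶠ x in U, χ (l ++ vals x) = χ l := by
    intro l
    filter_upwards [hUU _ (hχ l)] with x hx
    obtain ⟨y, h₁, h₂⟩ := (hx.and (hχ (l ++ vals x))).exists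
    rw [← h₁, ← h₂]
    simp [vals]
  obtain ⟨w, hw, hQ⟩ := exists_fusion (R := fun u => none ∈ u)
    (Q := fun l u => ∀ a : Fin (n + 1), (a : ℕ) ≤ m →
      φ (l ++ inst u a) = χ l ∧ χ (l ++ inst u a) = χ l) (by
    intro L hL
    have hA : ∀ᶠ x in U, ∀ l ∈ L, φ (l ++ vals x) = χ l ∧
        χ (l ++ vals x) = χ l :=
      (eventually_all_finite hL).2 fun l _ => (hχ l).and (hidem l)
    obtain ⟨u, hu, hline⟩ := hU _ hA
    refine ⟨u.map (Option.map Subtype.val), List.mem_map.2 ⟨none, hu, rfl⟩, fun l hl a ha => ?_⟩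
    have : inst (u.map (Option.map Subtype.val)) a = vals (inst u ⟨a, ha⟩) := by
      simp only [vals, inst, List.map_map]
      refine List.map_congr_left ?_
      rintro (_ | c) _ <;> rfl
    rw [this]
    exact hline ⟨a, ha⟩ l hl)
  refine ⟨w, hw, fun l => χ (sub w l), fun l a ha => ?_, fun l a ha => ?_⟩
  · rw [sub_concat]
    exact (hQ l a ha).1
  · rw [sub_concat]
    exact (hQ l a ha).2

theorem exists_stable {φ χ : List (Fin (n + 1)) → C} (h₀ : Stable 0 φ χ) (hφ : Sperner φ)
    (hc : ¬ HasChain φ) (m : ℕ) :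
    ∃ φ' χ' : List (Fin (n + 1)) → C, Stable m φ' χ' ∧ Sperner φ' ∧ ¬ HasChain φ' := by
  induction m with
  | zero => exact ⟨φ, χ, h₀, hφ, hc⟩
  | succ m ih =>
    obtain ⟨φ₁, χ₁, h₁, hφ₁, hc₁⟩ := ih
    obtain ⟨w, hw, h₂⟩ := h₁.exists_finiteRange hc₁
    obtain ⟨v, hv, χ', h₃⟩ := h₂.exists_stable
    exact ⟨_, χ', h₃, (hφ₁.comp_sub hw).comp_sub hv, fun h => hc₁ h.of_comp_sub.of_comp_sub⟩

theorem Stable.not_sperner {φ χ : List (Fin (n + 1)) → C} (h : Stable n φ χ) : ¬ Sperner φ := by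
  intro hφ
  refine hφ [] [] [] [] rfl ?_
  rw [List.nil_append, List.nil_append, ← List.nil_append [_], ← List.nil_append [Fin.last n],
    h.concat_left _ _ (by simp), h.concat_left _ _ (by simp)]

theorem Sperner.hasChain {φ : List (Fin (n + 1)) → C} (hφ : Sperner φ)
    (h : ∀ l, φ (l ++ [0]) = φ l) : HasChain φ := by
  by_contra hc
  obtain ⟨φ', χ', h', hφ', -⟩ := exists_stable (χ := φ)
    ⟨fun l a ha => by rw [Fin.ext (Nat.le_zero.1 ha) (b := 0), h],
      fun l a ha => by rw [Fin.ext (Nat.le_zero.1 ha) (b := 0), h]⟩ hφ hc n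
  exact h'.not_sperner hφ'

end Words

end SpernerList

theorem c0_sperner_chain (n : ℕ) (hn : 0 < n) {C : Type*}
    (φ : (ℕ → Fin (n + 1)) → C) (hφ : SpernerColouringLt n φ) :
    ∃ σ : ℕ → (ℕ → Fin (n + 1)), ∃ τ : ℕ → C,
      (∀ k, {i | σ k i ≠ 0}.Finite) ∧
      Function.Injective τ ∧
      (∀ k, ∀ j ≤ k, τ j ∈ φ '' cubeLt n (σ k)) ∧
      (∀ k, ∀ i, σ k i ≠ 0 → σ (k + 1) i = σ k i) := by
  have hfin : ∀ l : List (Fin (n + 1)), {i | l.getD i 0 ≠ 0}.Finite := fun l =>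
    (Set.finite_lt_nat l.length).subset fun i hi => by
      by_contra h
      exact hi (List.getD_eq_default _ _ (not_lt.1 h))
  have hS : SpernerList.Sperner fun l : List (Fin (n + 1)) => φ fun i => l.getD i 0 := by
    intro p p' s s' hp
    refine hφ _ _ (hfin _) (hfin _) ⟨p.length, Or.inl ⟨?_, ?_⟩⟩
    · simp
    · simp [hp]
  obtain ⟨l, τ, hτ, hc, hl⟩ := hS.hasChain fun l => by
    congr 1
    funext i
    rcases lt_trichotomy i l.length with h | rfl | h
    · rw [List.getD_append _ _ _ _ h]
    · simp
    · rw [List.getD_eq_default _ _ (by simpa using h), List.getD_eq_default _ _ h.le]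
  refine ⟨fun k i => (l k).getD i 0, τ, fun k => hfin _, hτ, fun k j hj => ?_, fun k i hi => ?_⟩
  · obtain ⟨ρ, hρ, e⟩ := hc k j hj
    refine ⟨_, ⟨fun i => decide ((l k).getD i 0 ≠ ρ.getD i 0), ?_, fun i => ?_⟩, e⟩
    · refine ((hfin (l k)).union (hfin ρ)).subset fun i hi => ?_
      by_contra h
      simp_all
    · have hstep : SpernerList.Step ((l k).getD i 0) (ρ.getD i 0) := by
        rcases lt_or_ge i (l k).length with h | h
        · have h' := hρ.length_eq ▸ h
          rw [List.getD_eq_getElem _ _ h, List.getD_eq_getElem _ _ h']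
          exact (List.forall₂_iff_get.1 hρ).2 i h h'
        · rw [List.getD_eq_default _ _ h, List.getD_eq_default _ _ (hρ.length_eq ▸ h)]
          exact .refl 0
      exact hstep.eq_min
  · obtain ⟨t, ht⟩ := hl k
    have h : i < (l k).length := by
      by_contra h
      exact hi (List.getD_eq_default _ _ (not_lt.1 h))
    simp only [← ht]
    exact List.getD_append _ _ _ _ h
end

section
/- For every positive integer m there exist an integer n ≥ m and a Sperner colouring φ : [n]^{<ω} → ℕ such that the image φ(K_σ^{<ω}) is a finite set for every σ ∈ [n]^{<ω}; thus the infinitary Sperner lemma fails for regular cubical subdivisions of the unit cube of c₀. -/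
/-- The colour of `σ`: a code for the level set `{i | 2 ≤ σ i}` (and `0` if this set is infinite). -/
noncomputable def levelColour (n : ℕ) (σ : ℕ → Fin (n + 1)) : ℕ :=
  open Classical in
  if h : {i | 2 ≤ (σ i : ℕ)}.Finite then Encodable.encode h.toFinset else 0

theorem finite_two_le {n : ℕ} {σ : ℕ → Fin (n + 1)} (h : {i | σ i ≠ 0}.Finite) :
    {i | 2 ≤ (σ i : ℕ)}.Finite :=
  h.subset fun i hi h0 => by simp [h0] at hi

theorem two_le_iff_of_levelColour_eq {n : ℕ} {σ σ' : ℕ → Fin (n + 1)}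
    (hσ : {i | σ i ≠ 0}.Finite) (hσ' : {i | σ' i ≠ 0}.Finite)
    (h : levelColour n σ = levelColour n σ') (i : ℕ) :
    2 ≤ (σ i : ℕ) ↔ 2 ≤ (σ' i : ℕ) := by
  rw [levelColour, levelColour, dif_pos (finite_two_le hσ), dif_pos (finite_two_le hσ')] at h
  simpa using Finset.ext_iff.mp (Encodable.encode_injective h) i

theorem spernerColouringLt_levelColour {n : ℕ} (hn : 2 ≤ n) :
    SpernerColouringLt n (levelColour n) := by
  rintro σ σ' hσ hσ' ⟨i, hi⟩ h
  have := two_le_iff_of_levelColour_eq hσ hσ' h i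
  omega

/-- On the cube with index `σ`, the level set `{i | 2 ≤ ρ i}` is contained in the support of `σ`. -/
theorem finite_levelColour_image_cubeLt {n : ℕ} {σ : ℕ → Fin (n + 1)}
    (hσ : {i | σ i ≠ 0}.Finite) : (levelColour n '' cubeLt n σ).Finite := by
  refine (hσ.toFinset.powerset.finite_toSet.image Encodable.encode).subset ?_
  rintro _ ⟨ρ, ⟨τ, -, hρ⟩, rfl⟩
  have hsub : {i | 2 ≤ (ρ i : ℕ)} ⊆ {i | σ i ≠ 0} := by
    intro i hi h0
    have h := hρ i
    simp only [Set.mem_ofPred_eq] at hi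
    simp only [h0, Fin.val_zero] at h
    split_ifs at h <;> omega
  have hfin := hσ.subset hsub
  refine ⟨hfin.toFinset, ?_, by rw [levelColour, dif_pos hfin]⟩
  simpa using hsub

theorem c0_sperner_fails (m : ℕ) (hm : 0 < m) :
    ∃ n : ℕ, m ≤ n ∧ ∃ φ : (ℕ → Fin (n + 1)) → ℕ,
      SpernerColouringLt n φ ∧
      ∀ σ : ℕ → Fin (n + 1), {i | σ i ≠ 0}.Finite → (φ '' cubeLt n σ).Finite :=
  ⟨m + 1, m.le_succ, levelColour (m + 1), spernerColouringLt_levelColour (by omega),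
    fun _ hσ => finite_levelColour_image_cubeLt hσ⟩
end

section
/- Let X be a paracompact Hausdorff topological space. Then every open cover of X has an open refinement which covers X and is Noetherian. -/
namespace PartitionOfUnity

variable {ι X : Type*} [TopologicalSpace X] (f : PartitionOfUnity ι X)

/-- The set of points at which the functions indexed by `S` are positive and strictly dominate
all the other functions of the partition of unity. -/
def dominanceSet (S : Finset ι) : Set X :=
  {x | ∀ i ∈ S, 0 < f i x ∧ ∀ j ∉ S, f j x < f i x}

theorem isOpen_dominanceSet (S : Finset ι) : IsOpen (f.dominanceSet S) := by
  rw [isOpen_iff_mem_nhds]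
  intro x hx
  obtain ⟨t, ht, hfin⟩ := f.locallyFinite x
  have hpos : ∀ᶠ y in nhds x, ∀ i ∈ S, 0 < f i y := by
    rw [Filter.eventually_all_finset]
    exact fun i hi => (f i).continuous.continuousAt.eventually_const_lt (hx i hi).1
  have hlt : ∀ᶠ y in nhds x, ∀ i ∈ S, ∀ j ∈ hfin.toFinset, j ∉ S → f j y < f i y := by
    simp only [Filter.eventually_all_finset]
    intro i hi j _
    by_cases hj : j ∈ S
    · simp [hj]
    · filter_upwards [(f j).continuous.continuousAt.eventually_lt
        (f i).continuous.continuousAt ((hx i hi).2 j hj)] with y hy _ using hy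
  filter_upwards [ht, hpos, hlt] with y hyt hyp hyl i hi
  refine ⟨hyp i hi, fun j hj => ?_⟩
  by_cases h0 : f j y = 0
  · rw [h0]
    exact hyp i hi
  · exact hyl i hi j (hfin.mem_toFinset.2 ⟨y, h0, hyt⟩) hj

theorem eq_of_mem_dominanceSet {S T : Finset ι} (hcard : S.card = T.card) {x : X}
    (hS : x ∈ f.dominanceSet S) (hT : x ∈ f.dominanceSet T) : S = T := by
  by_contra hne
  obtain ⟨i, hi, hiT⟩ := Finset.not_subset.1
    fun h => hne (Finset.eq_of_subset_of_card_le h hcard.ge)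
  obtain ⟨j, hj, hjS⟩ := Finset.not_subset.1
    fun h => hne (Finset.eq_of_subset_of_card_le h hcard.le).symm
  exact lt_asymm ((hS i hi).2 j hjS) ((hT j hj).2 i hiT)

/-- The sum of the squares of the functions of a partition of unity. -/
noncomputable def sumSq (x : X) : ℝ := ∑ᶠ i, f i x ^ 2

theorem continuous_sumSq : Continuous f.sumSq := by
  refine continuous_finsum (fun i => (f i).continuous.pow 2) (f.locallyFinite.subset ?_)
  intro i x hx h0
  exact hx (by simp [h0])

theorem exists_mem_dominanceSet (x : X) :
    0 < f.sumSq x ∧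
      ∃ S : Finset ι, S.Nonempty ∧ x ∈ f.dominanceSet S ∧ (S.card : ℝ) ≤ (f.sumSq x)⁻¹ := by
  classical
  have hfin : (Function.support fun i => f i x).Finite := f.locallyFinite.point_finite x
  set F := hfin.toFinset
  have hmem : ∀ i, i ∈ F ↔ f i x ≠ 0 := fun i => by simp [F]
  have hsum : ∑ i ∈ F, f i x = 1 := by
    rw [← f.sum_eq_one (Set.mem_univ x)]
    exact (finsum_eq_sum_of_support_subset _ (by simp [F])).symm
  have hsq : f.sumSq x = ∑ i ∈ F, f i x ^ 2 :=
    finsum_eq_sum_of_support_subset _ fun i hi => (hmem i).2 fun h0 => hi (by simp [h0])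
  have hF : F.Nonempty := by
    by_contra h
    simp [Finset.not_nonempty_iff_eq_empty.1 h] at hsum
  have hpos : ∀ i ∈ F, 0 < f i x := fun i hi => (f.nonneg i x).lt_of_ne' ((hmem i).1 hi)
  have hsq_pos : 0 < f.sumSq x := by
    rw [hsq]
    exact Finset.sum_pos (fun i hi => pow_pos (hpos i hi) 2) hF
  obtain ⟨m, hm, hmax⟩ := F.exists_max_image (fun i => f i x) hF
  refine ⟨hsq_pos, F.filter fun i => f i x = f m x, ⟨m, by simp [hm]⟩, ?_, ?_⟩
  · intro i hi
    obtain ⟨hiF, him⟩ := Finset.mem_filter.1 hi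
    refine ⟨hpos i hiF, fun j hj => ?_⟩
    by_cases hjF : j ∈ F
    · rw [him]
      exact (hmax j hjF).lt_of_ne fun h => hj (Finset.mem_filter.2 ⟨hjF, h⟩)
    · rw [not_not.1 (mt (hmem j).2 hjF)]
      exact hpos i hiF
  · have hle : f.sumSq x ≤ f m x := by
      calc f.sumSq x = ∑ i ∈ F, f i x ^ 2 := hsq
        _ ≤ ∑ i ∈ F, f m x * f i x := Finset.sum_le_sum fun i hi => by
            rw [sq]
            exact mul_le_mul_of_nonneg_right (hmax i hi) (hpos i hi).le
        _ = f m x := by rw [← Finset.mul_sum, hsum, mul_one]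
    have hcard : ((F.filter fun i => f i x = f m x).card : ℝ) * f m x ≤ 1 := by
      calc ((F.filter fun i => f i x = f m x).card : ℝ) * f m x
          = ∑ i ∈ F.filter fun i => f i x = f m x, f i x := by
            rw [Finset.sum_congr rfl fun i hi => (Finset.mem_filter.1 hi).2]
            simp
        _ ≤ ∑ i ∈ F, f i x := Finset.sum_le_sum_of_subset_of_nonneg (Finset.filter_subset _ _)
            fun i _ _ => f.nonneg i x
        _ = 1 := hsum
    rw [← one_div, le_div_iff₀ hsq_pos]
    exact (mul_le_mul_of_nonneg_left hle (Nat.cast_nonneg _)).trans hcard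

/-- The part of `f.dominanceSet S` on which the inverse of `f.sumSq` is within distance `1`
of `N`. -/
def dominanceSlice (S : Finset ι) (N : ℕ) : Set X :=
  f.dominanceSet S ∩ {x | |(f.sumSq x)⁻¹ - N| < 1}

theorem isOpen_dominanceSlice (S : Finset ι) (N : ℕ) : IsOpen (f.dominanceSlice S N) := by
  have hcont : Continuous fun x => (f.sumSq x)⁻¹ :=
    f.continuous_sumSq.inv₀ fun x => (f.exists_mem_dominanceSet x).1.ne'
  exact (f.isOpen_dominanceSet S).inter
    (isOpen_lt (hcont.sub continuous_const).abs continuous_const)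

theorem exists_mem_dominanceSlice (x : X) :
    ∃ S : Finset ι, ∃ N : ℕ, S.Nonempty ∧ S.card ≤ N ∧ x ∈ f.dominanceSlice S N := by
  obtain ⟨hpos, S, hS, hx, hcard⟩ := f.exists_mem_dominanceSet x
  refine ⟨S, ⌊(f.sumSq x)⁻¹⌋₊, hS, Nat.le_floor hcard, hx, ?_⟩
  have h₁ := Nat.floor_le (inv_pos.2 hpos).le
  have h₂ := Nat.lt_floor_add_one (f.sumSq x)⁻¹
  simp only [Set.mem_ofPred_eq, abs_lt]
  constructor <;> linarith

theorem isNoetherianCover_dominanceSlice :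
    IsNoetherianCover {V | ∃ S : Finset ι, ∃ N : ℕ, S.Nonempty ∧ S.card ≤ N ∧
      V = f.dominanceSlice S N} := by
  rintro ⟨V, hinj, hV, hne⟩
  choose S N _ hcard hVeq using hV
  have hmeet : ∀ j k, ∃ x, x ∈ V j ∧ x ∈ V k := by
    intro j k
    obtain ⟨x, hx⟩ := hne (max j k)
    simp only [Set.mem_iInter, Finset.mem_range] at hx
    exact ⟨x, hx j (by omega), hx k (by omega)⟩
  have hN : ∀ k, N k ≤ N 0 + 1 := by
    intro k
    obtain ⟨x, h₀, hk⟩ := hmeet 0 k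
    rw [hVeq] at h₀ hk
    obtain ⟨-, h₁⟩ := h₀
    obtain ⟨-, h₂⟩ := hk
    simp only [Set.mem_ofPred_eq, abs_lt] at h₁ h₂
    have : (N k : ℝ) < N 0 + 2 := by linarith
    have : N k < N 0 + 2 := by exact_mod_cast this
    omega
  obtain ⟨j, -, k, -, hjk, heq⟩ := Set.infinite_univ.exists_ne_map_eq_of_mapsTo
    (f := fun k => (N k, (S k).card)) (t := Set.Iic (N 0 + 1, N 0 + 1))
    (fun k _ => ⟨hN k, (hcard k).trans (hN k)⟩) (Set.finite_Iic _)
  obtain ⟨hNjk, hSjk⟩ := Prod.mk.inj heq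
  obtain ⟨x, hj, hk⟩ := hmeet j k
  rw [hVeq] at hj hk
  apply hjk
  apply hinj
  rw [hVeq j, hVeq k, f.eq_of_mem_dominanceSet hSjk hj.1 hk.1, hNjk]

end PartitionOfUnity

theorem paracompact_noetherian_refinement
    (X : Type*) [TopologicalSpace X] [ParacompactSpace X] [T2Space X]
    (𝒰 : Set (Set X)) (hopen : ∀ U ∈ 𝒰, IsOpen U) (hcov : ⋃₀ 𝒰 = Set.univ) :
    ∃ 𝒱 : Set (Set X), (∀ V ∈ 𝒱, IsOpen V) ∧ ⋃₀ 𝒱 = Set.univ ∧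
      (∀ V ∈ 𝒱, ∃ U ∈ 𝒰, V ⊆ U) ∧ IsNoetherianCover 𝒱 := by
  obtain ⟨f, hf⟩ := PartitionOfUnity.exists_isSubordinate isClosed_univ
    (fun U : 𝒰 => (U : Set X)) (fun U => hopen U U.2)
    (by rw [← Set.sUnion_eq_iUnion, hcov])
  refine ⟨_, ?_, ?_, ?_, f.isNoetherianCover_dominanceSlice⟩
  · rintro _ ⟨S, N, -, -, rfl⟩
    exact f.isOpen_dominanceSlice S N
  · refine Set.eq_univ_of_forall fun x => ?_
    obtain ⟨S, N, hS, hN, hx⟩ := f.exists_mem_dominanceSlice x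
    exact ⟨_, ⟨S, N, hS, hN, rfl⟩, hx⟩
  · rintro _ ⟨S, N, ⟨i, hi⟩, -, rfl⟩
    exact ⟨i, i.2, fun x hx => hf i (subset_tsupport _ (hx.1 i hi).1.ne')⟩
end

section
/- Let n be a positive integer and let 𝒢 be a cover of [n]^ω. Then for every σ ∈ [n]^ω there exists A ∈ 𝒜(∅) such that ℓ(σ, A, 𝒢) = ℓ(σ, A′, 𝒢) for all A′ ∈ 𝒜(A). -/
/-- `B(σ,A,k)`: all `τ ∈ [n]^ω` with `|σ(i) − τ(i)| ≤ k` for `i ∈ A` and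
`τ(i) = σ(i)` for `i ∉ A`. -/
def cball (n : ℕ) (σ : ℕ → Fin (n + 1)) (A : Set ℕ) (k : ℕ) :
    Set (ℕ → Fin (n + 1)) :=
  {τ | (∀ i ∈ A, |(σ i : ℤ) - (τ i : ℤ)| ≤ (k : ℤ)) ∧ ∀ i ∉ A, τ i = σ i}

/-- `𝒜(S)`: all `A ⊆ ℕ` containing `S` with both `A \ S` and `ℕ \ A` infinite. -/
def calA (S : Set ℕ) : Set (Set ℕ) :=
  {A | S ⊆ A ∧ (A \ S).Infinite ∧ (Aᶜ).Infinite}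

/-- `B̂(σ,A,L) = ⋃ {B(σ, A'∖A, L) : A' ∈ 𝒜(A)}`. -/
def bhat (n : ℕ) (σ : ℕ → Fin (n + 1)) (A : Set ℕ) (L : ℕ) :
    Set (ℕ → Fin (n + 1)) :=
  ⋃ A' ∈ calA A, cball n σ (A' \ A) L

/-- The local relative Lebesgue number `ℓ(σ,A,𝒢)`: the greatest `k ≤ n` such that
`B̂(σ,A,k) ⊆ G` for some `G ∈ 𝒢`. -/
noncomputable def ell (n : ℕ) (σ : ℕ → Fin (n + 1)) (A : Set ℕ)
    (𝒢 : Set (Set (ℕ → Fin (n + 1)))) : ℕ :=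
  sSup {k | k ≤ n ∧ ∃ G ∈ 𝒢, bhat n σ A k ⊆ G}

theorem cball_mono {n : ℕ} (σ : ℕ → Fin (n + 1)) {A B : Set ℕ} (h : A ⊆ B) (k : ℕ) :
    cball n σ A k ⊆ cball n σ B k := by
  rintro τ ⟨h₁, h₂⟩
  refine ⟨fun i _ => ?_, fun i hi => h₂ i fun hA => hi (h hA)⟩
  by_cases hA : i ∈ A
  · exact h₁ i hA
  · simp [h₂ i hA]

theorem calA_anti {S T : Set ℕ} (h : S ⊆ T) : calA T ⊆ calA S := fun _ hA =>
  ⟨h.trans hA.1, hA.2.1.mono (Set.sdiff_subset_sdiff_right h), hA.2.2⟩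

theorem bhat_anti {n : ℕ} (σ : ℕ → Fin (n + 1)) {A B : Set ℕ} (h : A ⊆ B) (k : ℕ) :
    bhat n σ B k ⊆ bhat n σ A k :=
  Set.biUnion_mono (calA_anti h) fun _ _ =>
    cball_mono σ (Set.sdiff_subset_sdiff_right h) k

theorem ell_le (n : ℕ) (σ : ℕ → Fin (n + 1)) (A : Set ℕ)
    (𝒢 : Set (Set (ℕ → Fin (n + 1)))) : ell n σ A 𝒢 ≤ n :=
  csSup_le' fun _ hk => hk.1

theorem ell_mono {n : ℕ} (σ : ℕ → Fin (n + 1)) {A B : Set ℕ} (h : A ⊆ B)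
    (𝒢 : Set (Set (ℕ → Fin (n + 1)))) : ell n σ A 𝒢 ≤ ell n σ B 𝒢 :=
  csSup_le_csSup' ⟨n, fun _ hk => hk.1⟩ fun k ⟨hk, G, hG, hs⟩ =>
    ⟨hk, G, hG, (bhat_anti σ h k).trans hs⟩

theorem calA_empty_nonempty : (calA ∅).Nonempty := by
  refine ⟨{i | Even i}, Set.empty_subset _, ?_, ?_⟩
  · rw [Set.sdiff_empty]
    exact Set.infinite_of_forall_exists_gt fun a => ⟨2 * (a + 1), by simp, by omega⟩
  · exact Set.infinite_of_forall_exists_gt fun a => ⟨2 * a + 1, by simp, by omega⟩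

theorem stabilizing_lebesgue_number (n : ℕ) (hn : 0 < n)
    (𝒢 : Set (Set (ℕ → Fin (n + 1)))) (hcov : ⋃₀ 𝒢 = Set.univ)
    (σ : ℕ → Fin (n + 1)) :
    ∃ A ∈ calA ∅, ∀ A' ∈ calA A, ell n σ A 𝒢 = ell n σ A' 𝒢 := by
  obtain ⟨A, hA, hmin⟩ :=
    (measure fun A : Set ℕ => n - ell n σ A 𝒢).wf.has_min (calA ∅) calA_empty_nonempty
  refine ⟨A, hA, fun A' hA' => (ell_mono σ hA'.1 𝒢).antisymm ?_⟩
  have h : ¬ n - ell n σ A' 𝒢 < n - ell n σ A 𝒢 :=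
    hmin A' (calA_anti (Set.empty_subset A) hA')
  have := ell_le n σ A' 𝒢
  omega
end
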